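/- arXiv:1711.04282 — 10 statements merged into one kernel-verified Lean document; each statement's English description precedes it below -/
import Mathlib

section
/- Under assumptions (A1), (A2) and (A3), a strictly stationary version of the bivariate process ((Y_t,λ_t))_{t∈ℤ} is ergodic; that is, the two-sided shift map on the path space ([0,∞)×[0,∞))^ℤ is an ergodic measure-preserving transformation with respect to the law of the process. -/
open MeasureTheory

/-- Total variation distance between two measures:
`TV(Q₁,Q₂) = sup_{A measurable} |Q₁(A) − Q₂(A)|`. -/
noncomputable def tvDist {S : Type*} [MeasurableSpace S] (μ ν : Measure S) : ℝ :=
  ⨆ A : {A : Set S // MeasurableSet A}, |(μ A.1).toReal - (ν A.1).toReal|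

open ProbabilityTheory Filter Topology
open scoped symmDiff ENNReal

section TotalVariation

variable {S : Type*} [MeasurableSpace S] (μ ν : Measure S)
  [IsProbabilityMeasure μ] [IsProbabilityMeasure ν]

theorem abs_measure_sub_le_tvDist {A : Set S} (hA : MeasurableSet A) :
    |μ.real A - ν.real A| ≤ tvDist μ ν := by
  refine le_ciSup (f := fun A : {A : Set S // MeasurableSet A} ↦
    |(μ A.1).toReal - (ν A.1).toReal|) ⟨1, ?_⟩ ⟨A, hA⟩
  rintro _ ⟨B, rfl⟩
  have h₁ : μ.real B.1 ≤ 1 := measureReal_le_one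
  have h₂ : ν.real B.1 ≤ 1 := measureReal_le_one
  have h₃ : 0 ≤ μ.real B.1 := measureReal_nonneg
  have h₄ : 0 ≤ ν.real B.1 := measureReal_nonneg
  change |μ.real B.1 - ν.real B.1| ≤ 1
  rw [abs_le]
  constructor <;> linarith

theorem integrable_of_mem_Icc {g : S → ℝ} (hg : Measurable g) {C : ℝ}
    (h : ∀ y, g y ∈ Set.Icc 0 C) : Integrable g μ :=
  Integrable.of_mem_Icc 0 C hg.aemeasurable (ae_of_all _ h)

theorem integral_sub_integral_le_tvDist {g : S → ℝ} (hg : Measurable g)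
    (h : ∀ y, g y ∈ Set.Icc (0 : ℝ) 1) :
    ∫ y, g y ∂μ - ∫ y, g y ∂ν ≤ tvDist μ ν := by
  have layer (ρ : Measure S) [IsProbabilityMeasure ρ] :
      ∫ y, g y ∂ρ = ∫ t in Set.Ioc 0 1, ρ.real {y | t ≤ g y} :=
    (integrable_of_mem_Icc ρ hg h).integral_eq_integral_Ioc_meas_le
      (ae_of_all _ fun y ↦ (h y).1) (ae_of_all _ fun y ↦ (h y).2)
  have hint (ρ : Measure S) [IsProbabilityMeasure ρ] :
      IntegrableOn (fun t ↦ ρ.real {y | t ≤ g y}) (Set.Ioc (0 : ℝ) 1) := by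
    have hanti : Antitone fun t ↦ ρ.real {y | t ≤ g y} := fun s t hst ↦
      measureReal_mono fun y hy ↦ le_trans hst hy
    exact Integrable.of_mem_Icc 0 1 hanti.measurable.aemeasurable
      (ae_of_all _ fun t ↦ ⟨measureReal_nonneg, measureReal_le_one⟩)
  rw [layer μ, layer ν, ← integral_sub (hint μ) (hint ν)]
  calc ∫ t in Set.Ioc (0 : ℝ) 1, (μ.real {y | t ≤ g y} - ν.real {y | t ≤ g y})
      ≤ ∫ _ in Set.Ioc (0 : ℝ) 1, tvDist μ ν :=
        integral_mono ((hint μ).sub (hint ν)) (integrable_const _) fun t ↦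
          (le_abs_self _).trans (abs_measure_sub_le_tvDist μ ν (measurableSet_le measurable_const hg))
    _ = tvDist μ ν := by simp

/-- If `u - v` is uniformly bounded away from `1`, then so is the difference of the integrals
of `u` and `v` against measures whose total variation distance is less than `1`. -/
theorem integral_sub_integral_le_one_sub_mul {u v : S → ℝ} (hu : Measurable u) (hv : Measurable v)
    (hu₁ : ∀ y, u y ∈ Set.Icc (0 : ℝ) 1) (hv₁ : ∀ y, v y ∈ Set.Icc (0 : ℝ) 1) {η : ℝ} (hη : 0 < η)
    (huv : ∀ y, u y - v y ≤ 1 - η) :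
    ∫ y, u y ∂μ - ∫ y, v y ∂ν ≤ 1 - η * (1 - tvDist μ ν) := by
  set g : S → ℝ := fun y ↦ min (v y) η / η
  have hg : Measurable g := (hv.min measurable_const).div_const η
  have hg₁ (y : S) : g y ∈ Set.Icc (0 : ℝ) 1 :=
    ⟨div_nonneg (le_min (hv₁ y).1 hη.le) hη.le, div_le_one_of_le₀ (min_le_right _ _) hη.le⟩
  have hmul (y : S) : η * g y = min (v y) η := mul_div_cancel₀ _ hη.ne'
  have h₁ : ∫ y, u y ∂μ ≤ (1 - η) + η * ∫ y, g y ∂μ := by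
    calc ∫ y, u y ∂μ ≤ ∫ y, ((1 - η) + η * g y) ∂μ := by
          refine integral_mono (integrable_of_mem_Icc μ hu hu₁)
            ((integrable_const _).add ((integrable_of_mem_Icc μ hg hg₁).const_mul η)) fun y ↦ ?_
          have := huv y
          have := (hu₁ y).2
          simp only [hmul]
          rcases le_total (v y) η with h | h <;> simp [h] <;> linarith
      _ = (1 - η) + η * ∫ y, g y ∂μ := by
          rw [integral_add (integrable_const _) ((integrable_of_mem_Icc μ hg hg₁).const_mul η),
            integral_const_mul]
          simp
  have h₂ : η * ∫ y, g y ∂ν ≤ ∫ y, v y ∂ν := by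
    rw [← integral_const_mul]
    refine integral_mono ((integrable_of_mem_Icc ν hg hg₁).const_mul η)
      (integrable_of_mem_Icc ν hv hv₁) fun y ↦ ?_
    simp only [hmul]
    exact min_le_left _ _
  have h₃ := mul_le_mul_of_nonneg_left (integral_sub_integral_le_tvDist μ ν hg hg₁) hη.le
  linarith

/-- Measures at total variation distance less than `1` are not mutually singular. -/
theorem exists_and_of_ae_of_tvDist_lt_one (h : tvDist μ ν < 1) {p p' : S → Prop}
    (hp : ∀ᵐ y ∂μ, p y) (hp' : ∀ᵐ y ∂ν, p' y) : ∃ y, p y ∧ p' y := by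
  by_contra! hcon
  set N := toMeasurable μ {y | ¬ p y}
  have hNm : MeasurableSet N := measurableSet_toMeasurable _ _
  have hN : μ N = 0 := (measure_toMeasurable _).trans hp
  have hNc : ν Nᶜ = 0 := by
    refine measure_mono_null (fun y hy ↦ ?_) hp'
    exact hcon y (by_contra fun hy' ↦ hy (subset_toMeasurable _ _ hy'))
  have hN₁ : ν.real N = 1 := by
    have := probReal_add_probReal_compl (μ := ν) hNm
    simpa [measureReal_def, hNc] using this
  have := abs_measure_sub_le_tvDist μ ν hNm
  rw [hN₁, measureReal_def, hN] at this
  norm_num at this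
  linarith

end TotalVariation

section TransitionOperator

variable {H S : Type*} [MeasurableSpace H] [MeasurableSpace S] (κ : Kernel H S) (s : H → S → H)

/-- The transition operator of the chain on `H` which moves from `x` to `s x y`, with `y` drawn
from `κ x`. -/
noncomputable def transitionOp (ψ : H → ℝ) (x : H) : ℝ := ∫ y, ψ (s x y) ∂κ x

variable {κ s} [IsMarkovKernel κ]

theorem measurable_transitionOp (hs : Measurable (Function.uncurry s)) {ψ : H → ℝ}
    (hψ : Measurable ψ) : Measurable (transitionOp κ s ψ) :=
  (StronglyMeasurable.integral_kernel_prod_right (f := fun x y ↦ ψ (s x y))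
    (hψ.comp hs).stronglyMeasurable).measurable

theorem transitionOp_mem_Icc (hs : Measurable (Function.uncurry s)) {ψ : H → ℝ}
    (hψ : Measurable ψ) (h : ∀ x, ψ x ∈ Set.Icc (0 : ℝ) 1) (x : H) :
    transitionOp κ s ψ x ∈ Set.Icc (0 : ℝ) 1 := by
  refine ⟨integral_nonneg fun y ↦ (h _).1, ?_⟩
  calc transitionOp κ s ψ x ≤ ∫ _, (1 : ℝ) ∂κ x :=
        integral_mono (integrable_of_mem_Icc _ (hψ.comp hs.of_uncurry_left) fun y ↦ h _)
          (integrable_const _) fun y ↦ (h _).2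
    _ = 1 := by simp

theorem measurable_iterate_transitionOp (hs : Measurable (Function.uncurry s)) {ψ : H → ℝ}
    (hψ : Measurable ψ) (n : ℕ) : Measurable ((transitionOp κ s)^[n] ψ) := by
  induction n with
  | zero => exact hψ
  | succ n ih =>
    rw [Function.iterate_succ_apply']
    exact measurable_transitionOp hs ih

theorem iterate_transitionOp_mem_Icc (hs : Measurable (Function.uncurry s)) {ψ : H → ℝ}
    (hψ : Measurable ψ) (h : ∀ x, ψ x ∈ Set.Icc (0 : ℝ) 1) (n : ℕ) (x : H) :
    (transitionOp κ s)^[n] ψ x ∈ Set.Icc (0 : ℝ) 1 := by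
  induction n generalizing x with
  | zero => exact h x
  | succ n ih =>
    rw [Function.iterate_succ_apply']
    exact transitionOp_mem_Icc hs (measurable_iterate_transitionOp hs hψ n) ih x

variable {π : Measure H} [IsProbabilityMeasure π]

theorem ae_ae_step_of_ae (hs : Measurable (Function.uncurry s))
    (hπ : (π ⊗ₘ κ).map (Function.uncurry s) = π) {G : H → Prop} (hG : ∀ᵐ x ∂π, G x) :
    ∀ᵐ x ∂π, ∀ᵐ y ∂κ x, G (s x y) := by
  rw [← hπ] at hG
  exact Measure.ae_ae_of_ae_compProd (ae_of_ae_map hs.aemeasurable hG)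

theorem lintegral_enorm_transitionOp_sub_le (hs : Measurable (Function.uncurry s))
    (hπ : (π ⊗ₘ κ).map (Function.uncurry s) = π) {ψ φ : H → ℝ} (hψ : Measurable ψ)
    (hψ₁ : ∀ x, ψ x ∈ Set.Icc (0 : ℝ) 1) (hφ : Measurable φ)
    (hφs : ∀ᵐ x ∂π, ∀ᵐ y ∂κ x, φ (s x y) = φ x) :
    ∫⁻ x, ‖transitionOp κ s ψ x - φ x‖ₑ ∂π ≤ ∫⁻ x, ‖ψ x - φ x‖ₑ ∂π := by
  have hm : Measurable fun x ↦ ‖ψ x - φ x‖ₑ := (hψ.sub hφ).enorm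
  calc ∫⁻ x, ‖transitionOp κ s ψ x - φ x‖ₑ ∂π
      ≤ ∫⁻ x, ∫⁻ y, ‖ψ (s x y) - φ (s x y)‖ₑ ∂κ x ∂π := by
        refine lintegral_mono_ae ?_
        filter_upwards [hφs] with x hx
        have hi : Integrable (fun y ↦ ψ (s x y)) (κ x) :=
          integrable_of_mem_Icc _ (hψ.comp hs.of_uncurry_left) fun y ↦ hψ₁ _
        have : transitionOp κ s ψ x - φ x = ∫ y, (ψ (s x y) - φ x) ∂κ x := by
          rw [integral_sub hi (integrable_const _)]
          simp [transitionOp]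
        rw [this]
        refine (enorm_integral_le_lintegral_enorm _).trans_eq (lintegral_congr_ae ?_)
        filter_upwards [hx] with y hy
        rw [hy]
    _ = ∫⁻ z, ‖ψ (Function.uncurry s z) - φ (Function.uncurry s z)‖ₑ ∂(π ⊗ₘ κ) :=
        (Measure.lintegral_compProd (hm.comp hs)).symm
    _ = ∫⁻ x, ‖ψ x - φ x‖ₑ ∂((π ⊗ₘ κ).map (Function.uncurry s)) := (lintegral_map hm hs).symm
    _ = ∫⁻ x, ‖ψ x - φ x‖ₑ ∂π := by rw [hπ]

theorem lintegral_enorm_iterate_transitionOp_sub_le (hs : Measurable (Function.uncurry s))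
    (hπ : (π ⊗ₘ κ).map (Function.uncurry s) = π) {ψ φ : H → ℝ} (hψ : Measurable ψ)
    (hψ₁ : ∀ x, ψ x ∈ Set.Icc (0 : ℝ) 1) (hφ : Measurable φ)
    (hφs : ∀ᵐ x ∂π, ∀ᵐ y ∂κ x, φ (s x y) = φ x) (n : ℕ) :
    ∫⁻ x, ‖(transitionOp κ s)^[n] ψ x - φ x‖ₑ ∂π ≤ ∫⁻ x, ‖ψ x - φ x‖ₑ ∂π := by
  induction n with
  | zero => rfl
  | succ n ih =>
    rw [Function.iterate_succ_apply']
    exact (lintegral_enorm_transitionOp_sub_le hs hπ (measurable_iterate_transitionOp hs hψ n)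
      (iterate_transitionOp_mem_Icc hs hψ hψ₁ n) hφ hφs).trans ih

end TransitionOperator

section History

variable {p q : ℕ} (f : (Fin (p + 1) → ℝ) → (Fin (q + 1) → ℝ) → ℝ)

/-- The intensity determined by a history `x`, where `x i` is the observation-intensity pair
`i + 1` time steps ago. -/
def nextIntensity (x : ℕ → ℝ × ℝ) : ℝ := f (fun i ↦ (x i).1) (fun j ↦ (x j).2)

/-- The history obtained from `x` after the observation `y`. -/
def historyStep (x : ℕ → ℝ × ℝ) (y : ℝ) : ℕ → ℝ × ℝ
  | 0 => (y, nextIntensity f x)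
  | i + 1 => x i

/-- The last `k` observations of the two histories coincide. -/
def ObsAgree (k : ℕ) (x x' : ℕ → ℝ × ℝ) : Prop := ∀ i < k, (x i).1 = (x' i).1

/-- The last `q + 1` intensities of the two histories are close, with weights `r ^ j`. -/
def IntensityClose (q : ℕ) (r w : ℝ) (x x' : ℕ → ℝ × ℝ) : Prop :=
  ∀ j ≤ q, r ^ j * |(x j).2 - (x' j).2| ≤ w

variable {f}

theorem measurable_nextIntensity (hf : Measurable (Function.uncurry f)) :
    Measurable (nextIntensity f) :=
  hf.comp (f := fun x : ℕ → ℝ × ℝ ↦ (fun i : Fin (p + 1) ↦ (x i).1, fun j : Fin (q + 1) ↦ (x j).2))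
    (by fun_prop)

theorem measurable_historyStep (hf : Measurable (Function.uncurry f)) :
    Measurable (Function.uncurry (historyStep f)) := by
  refine measurable_pi_lambda _ fun i ↦ ?_
  cases i with
  | zero => exact measurable_snd.prodMk ((measurable_nextIntensity hf).comp measurable_fst)
  | succ i => exact (measurable_pi_apply i).comp measurable_fst

theorem ObsAgree.historyStep {k : ℕ} {x x' : ℕ → ℝ × ℝ} (h : ObsAgree k x x') (y : ℝ) :
    ObsAgree (k + 1) (historyStep f x y) (historyStep f x' y) := by
  intro i hi
  cases i with
  | zero => rfl
  | succ i => exact h i (by omega)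

theorem ObsAgree.mono {k l : ℕ} (hkl : k ≤ l) {x x' : ℕ → ℝ × ℝ} (h : ObsAgree l x x') :
    ObsAgree k x x' := fun i hi ↦ h i (hi.trans_le hkl)

variable {c : Fin (q + 1) → ℝ} {r : ℝ}

theorem abs_nextIntensity_sub_le (hc : ∀ i, 0 ≤ c i)
    (hcontr : ∀ (y : Fin (p + 1) → ℝ) (z z' : Fin (q + 1) → ℝ),
      |f y z - f y z'| ≤ ∑ i, c i * |z i - z' i|)
    (hr : 0 < r) (hr₁ : r < 1) (hcr : ∑ i, c i ≤ r ^ (q + 1)) {w : ℝ} {x x' : ℕ → ℝ × ℝ}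
    (hobs : ObsAgree (p + 1) x x') (hw : IntensityClose q r w x x') :
    |nextIntensity f x - nextIntensity f x'| ≤ r * w := by
  have hw₀ : 0 ≤ w := (by positivity : 0 ≤ r ^ 0 * |(x 0).2 - (x' 0).2|).trans (hw 0 q.zero_le)
  have hy : (fun i : Fin (p + 1) ↦ (x i).1) = fun i : Fin (p + 1) ↦ (x' i).1 :=
    funext fun i ↦ hobs i i.2
  have h := hcontr (fun i ↦ (x i).1) (fun j ↦ (x j).2) (fun j ↦ (x' j).2)
  refine le_of_mul_le_mul_left ?_ (pow_pos hr q)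
  calc r ^ q * |nextIntensity f x - nextIntensity f x'|
      ≤ r ^ q * ∑ i : Fin (q + 1), c i * |(x i).2 - (x' i).2| := by
        refine mul_le_mul_of_nonneg_left ?_ (by positivity)
        simpa only [nextIntensity, ← hy] using h
    _ = ∑ i : Fin (q + 1), c i * (r ^ q * |(x i).2 - (x' i).2|) := by
        rw [Finset.mul_sum]
        exact Finset.sum_congr rfl fun i _ ↦ by ring
    _ ≤ ∑ i : Fin (q + 1), c i * w := by
        refine Finset.sum_le_sum fun i _ ↦ mul_le_mul_of_nonneg_left ?_ (hc i)
        refine (mul_le_mul_of_nonneg_right ?_ (abs_nonneg _)).trans (hw i (by omega))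
        exact pow_le_pow_of_le_one hr.le hr₁.le (by omega)
    _ ≤ r ^ (q + 1) * w := by
        rw [← Finset.sum_mul]
        exact mul_le_mul_of_nonneg_right hcr hw₀
    _ = r ^ q * (r * w) := by ring

theorem IntensityClose.historyStep (hc : ∀ i, 0 ≤ c i)
    (hcontr : ∀ (y : Fin (p + 1) → ℝ) (z z' : Fin (q + 1) → ℝ),
      |f y z - f y z'| ≤ ∑ i, c i * |z i - z' i|)
    (hr : 0 < r) (hr₁ : r < 1) (hcr : ∑ i, c i ≤ r ^ (q + 1)) {w : ℝ} {x x' : ℕ → ℝ × ℝ}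
    (hobs : ObsAgree (p + 1) x x') (hw : IntensityClose q r w x x') (y y' : ℝ) :
    IntensityClose q r (r * w) (historyStep f x y) (historyStep f x' y') := by
  intro j hj
  cases j with
  | zero =>
    simpa [_root_.historyStep] using abs_nextIntensity_sub_le hc hcontr hr hr₁ hcr hobs hw
  | succ j =>
    have := mul_le_mul_of_nonneg_left (hw j (by omega)) hr.le
    simpa only [_root_.historyStep, pow_succ', mul_assoc] using this

theorem intensityClose_sum (hr : 0 < r) (hr₁ : r < 1) (x x' : ℕ → ℝ × ℝ) :
    IntensityClose q r (∑ j ∈ Finset.range (q + 1), |(x j).2 - (x' j).2|) x x' := by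
  intro j hj
  calc r ^ j * |(x j).2 - (x' j).2| ≤ 1 * |(x j).2 - (x' j).2| :=
        mul_le_mul_of_nonneg_right (pow_le_one₀ hr.le hr₁.le) (abs_nonneg _)
    _ ≤ _ := by
        rw [one_mul]
        exact Finset.single_le_sum (f := fun j ↦ |(x j).2 - (x' j).2|)
          (fun _ _ ↦ abs_nonneg _) (Finset.mem_range.2 (by omega))

theorem exists_rate_of_sum_lt_one (hcsum : ∑ i, c i < 1) (hc : ∀ i, 0 ≤ c i) :
    ∃ r : ℝ, 0 < r ∧ r < 1 ∧ ∑ i, c i ≤ r ^ (q + 1) := by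
  set C := ∑ i, c i
  have hC : 0 ≤ C := Finset.sum_nonneg fun i _ ↦ hc i
  have hq : (0 : ℝ) ≤ q := q.cast_nonneg
  have ht : (1 - C) / (q + 2) ≤ 1 / 2 :=
    div_le_div₀ zero_le_one (by linarith) (by norm_num) (by linarith)
  have ht₀ : 0 < (1 - C) / (q + 2) := div_pos (by linarith) (by linarith)
  refine ⟨1 - (1 - C) / (q + 2), by linarith, by linarith, ?_⟩
  have hb := one_add_mul_le_pow (a := -((1 - C) / (q + 2))) (by linarith) (q + 1)
  have heq : (1 - C) / (q + 2) * (q + 2) = 1 - C := div_mul_cancel₀ _ (by linarith)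
  rw [← sub_eq_add_neg] at hb
  push_cast at hb
  nlinarith

section Coupling

variable {κ : Kernel (ℕ → ℝ × ℝ) ℝ} [IsMarkovKernel κ] {δ : ℝ}

/-- Two histories with the same recent observations have future observations whose laws over any
finite horizon overlap, uniformly in the horizon. -/
theorem iterate_transitionOp_sub_le (hf : Measurable (Function.uncurry f)) (hc : ∀ i, 0 ≤ c i)
    (hcontr : ∀ (y : Fin (p + 1) → ℝ) (z z' : Fin (q + 1) → ℝ),
      |f y z - f y z'| ≤ ∑ i, c i * |z i - z' i|)
    (hr : 0 < r) (hr₁ : r < 1) (hcr : ∑ i, c i ≤ r ^ (q + 1)) (hδ : 0 < δ)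
    (hκ : ∀ x x', tvDist (κ x) (κ x')
      ≤ 1 - Real.exp (-δ * |nextIntensity f x - nextIntensity f x'|))
    {ψ : (ℕ → ℝ × ℝ) → ℝ} (hψ : Measurable ψ) (hψ₁ : ∀ x, ψ x ∈ Set.Icc (0 : ℝ) 1) {N : ℕ}
    (hN : ∀ x x', ObsAgree N x x' → ψ x = ψ x') (n : ℕ) {k : ℕ} (hk : p + 1 ≤ k)
    (hkn : N ≤ k + n) {w : ℝ} {x x' : ℕ → ℝ × ℝ} (hobs : ObsAgree k x x')
    (hw : IntensityClose q r w x x') :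
    (transitionOp κ (historyStep f))^[n] ψ x - (transitionOp κ (historyStep f))^[n] ψ x'
      ≤ 1 - Real.exp (-δ * (w * (r / (1 - r)))) := by
  have hr' : 0 < 1 - r := by linarith
  have hs := measurable_historyStep hf
  induction n generalizing k w x x' with
  | zero =>
    have hw₀ : 0 ≤ w := (by positivity : 0 ≤ r ^ 0 * |(x 0).2 - (x' 0).2|).trans (hw 0 q.zero_le)
    have : 0 ≤ δ * (w * (r / (1 - r))) := by positivity
    simpa [hN x x' (hobs.mono hkn)] using this
  | succ n ih =>
    rw [Function.iterate_succ_apply']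
    have hm := measurable_iterate_transitionOp (κ := κ) hs hψ n
    have hI := iterate_transitionOp_mem_Icc (κ := κ) hs hψ hψ₁ n
    refine (integral_sub_integral_le_one_sub_mul (κ x) (κ x') (hm.comp hs.of_uncurry_left)
      (hm.comp hs.of_uncurry_left) (fun y ↦ hI _) (fun y ↦ hI _) (Real.exp_pos _)
      fun y ↦ ih (hk.trans k.le_succ) (by omega) (hobs.historyStep y)
        (hw.historyStep hc hcontr hr hr₁ hcr (hobs.mono hk) y y)).trans ?_
    have h₁ := abs_nextIntensity_sub_le hc hcontr hr hr₁ hcr (hobs.mono hk) hw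
    have h₂ : Real.exp (-δ * (r * w)) ≤ 1 - tvDist (κ x) (κ x') := by
      have : Real.exp (-δ * (r * w))
          ≤ Real.exp (-δ * |nextIntensity f x - nextIntensity f x'|) := by
        rw [Real.exp_le_exp]
        nlinarith
      linarith [hκ x x']
    have h₃ : Real.exp (-δ * (w * (r / (1 - r))))
        = Real.exp (-δ * (r * w * (r / (1 - r)))) * Real.exp (-δ * (r * w)) := by
      rw [← Real.exp_add]
      congr 1
      field_simp
      ring
    rw [h₃]
    exact sub_le_sub_left (mul_le_mul_of_nonneg_left h₂ (Real.exp_pos _).le) _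

variable {π : Measure (ℕ → ℝ × ℝ)} [IsProbabilityMeasure π]

theorem exists_obsAgree_of_absorbing (hf : Measurable (Function.uncurry f))
    (hκ : ∀ x x', tvDist (κ x) (κ x') < 1)
    (hπ : (π ⊗ₘ κ).map (Function.uncurry (historyStep f)) = π) {B : Set (ℕ → ℝ × ℝ)}
    (hBs : ∀ᵐ x ∂π, ∀ᵐ y ∂κ x, historyStep f x y ∈ B ↔ x ∈ B) (hB : π B ≠ 0) (hB' : π Bᶜ ≠ 0)
    (k : ℕ) {G : (ℕ → ℝ × ℝ) → Prop} (hG : ∀ᵐ x ∂π, G x) :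
    ∃ x x', G x ∧ x ∈ B ∧ G x' ∧ x' ∉ B ∧ ObsAgree k x x' := by
  induction k generalizing G with
  | zero =>
    obtain ⟨x, hx, hxG⟩ := ((frequently_ae_mem_iff.2 hB).and_eventually hG).exists
    obtain ⟨x', hx', hxG'⟩ := ((frequently_ae_mem_iff.2 hB').and_eventually hG).exists
    exact ⟨x, x', hxG, hx, hxG', hx', fun i hi ↦ absurd hi i.not_lt_zero⟩
  | succ k ih =>
    obtain ⟨x, x', ⟨hx₁, hx₂⟩, hx, ⟨hx₁', hx₂'⟩, hx', hobs⟩ :=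
      ih ((ae_ae_step_of_ae (measurable_historyStep hf) hπ hG).and hBs)
    obtain ⟨y, ⟨hy₁, hy₂⟩, hy₁', hy₂'⟩ :=
      exists_and_of_ae_of_tvDist_lt_one _ _ (hκ x x') (hx₁.and hx₂) (hx₁'.and hx₂')
    exact ⟨_, _, hy₁, hy₂.2 hx, hy₁', fun h ↦ hx' (hy₂'.1 h), hobs.historyStep y⟩

/-- An absorbing set of histories which can be approximated by events depending on finitely many
observations is trivial. -/
theorem measure_eq_zero_or_compl_of_absorbing (hf : Measurable (Function.uncurry f))
    (hc : ∀ i, 0 ≤ c i) (hcsum : ∑ i, c i < 1)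
    (hcontr : ∀ (y : Fin (p + 1) → ℝ) (z z' : Fin (q + 1) → ℝ),
      |f y z - f y z'| ≤ ∑ i, c i * |z i - z' i|) (hδ : 0 < δ)
    (hκ : ∀ x x', tvDist (κ x) (κ x')
      ≤ 1 - Real.exp (-δ * |nextIntensity f x - nextIntensity f x'|))
    (hπ : (π ⊗ₘ κ).map (Function.uncurry (historyStep f)) = π) {B : Set (ℕ → ℝ × ℝ)}
    (hBm : MeasurableSet B)
    (hBs : ∀ᵐ x ∂π, ∀ᵐ y ∂κ x, historyStep f x y ∈ B ↔ x ∈ B)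
    (happrox : ∀ ε : ℝ≥0∞, 0 < ε → ∃ (E : Set (ℕ → ℝ × ℝ)) (N : ℕ), MeasurableSet E ∧
      (∀ x x', ObsAgree N x x' → (x ∈ E ↔ x' ∈ E)) ∧ π (E ∆ B) < ε) :
    π B = 0 ∨ π Bᶜ = 0 := by
  by_contra! hcon
  obtain ⟨r, hr, hr₁, hcr⟩ := exists_rate_of_sum_lt_one hcsum hc
  obtain ⟨ε, hε, -, hε₀⟩ : ∃ ε : ℕ → ℝ≥0∞, (∀ n, 0 < ε n) ∧ (∀ n, ε n < ⊤) ∧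
      Tendsto ε atTop (𝓝 0) := by
    obtain ⟨ε, -, h, h'⟩ := exists_seq_strictAnti_tendsto' (x := (0 : ℝ≥0∞)) (y := ⊤) (by simp)
    exact ⟨ε, fun n ↦ (h n).1, fun n ↦ (h n).2, h'⟩
  choose E N hEm hEN hEε using fun n ↦ happrox (ε n) (hε n)
  set ψ : ℕ → (ℕ → ℝ × ℝ) → ℝ := fun n ↦ (E n).indicator 1
  set φ : (ℕ → ℝ × ℝ) → ℝ := B.indicator 1
  have hs := measurable_historyStep hf
  have hψ (n) : Measurable (ψ n) := measurable_one.indicator (hEm n)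
  have hψ₁ (n x) : ψ n x ∈ Set.Icc (0 : ℝ) 1 := by
    by_cases h : x ∈ E n <;> simp [ψ, h]
  have hφ : Measurable φ := measurable_one.indicator hBm
  have hφs : ∀ᵐ x ∂π, ∀ᵐ y ∂κ x, φ (historyStep f x y) = φ x := by
    filter_upwards [hBs] with x hx
    filter_upwards [hx] with y hy
    by_cases h : x ∈ B <;> simp [φ, h, hy]
  set h : ℕ → (ℕ → ℝ × ℝ) → ℝ := fun n ↦ (transitionOp κ (historyStep f))^[N n] (ψ n)
  have hle (n) : eLpNorm (h n - φ) 1 π ≤ ε n := by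
    rw [eLpNorm_one_eq_lintegral_enorm]
    refine (lintegral_enorm_iterate_transitionOp_sub_le hs hπ (hψ n) (hψ₁ n) hφ hφs (N n)).trans ?_
    refine le_trans (le_of_eq ?_) (hEε n).le
    rw [← lintegral_indicator_one ((hEm n).symmDiff hBm)]
    refine lintegral_congr fun x ↦ ?_
    by_cases h₁ : x ∈ E n <;> by_cases h₂ : x ∈ B <;> simp [ψ, φ, h₁, h₂, Set.mem_symmDiff]
  have hmeas : TendstoInMeasure π h atTop φ :=
    tendstoInMeasure_of_tendsto_eLpNorm one_ne_zero
      (fun n ↦ (measurable_iterate_transitionOp hs (hψ n) _).aestronglyMeasurable)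
      hφ.aestronglyMeasurable
      (tendsto_of_tendsto_of_tendsto_of_le_of_le tendsto_const_nhds hε₀ (fun _ ↦ zero_le) hle)
  obtain ⟨ns, -, hns⟩ := hmeas.exists_seq_tendsto_ae
  obtain ⟨x, x', hx, hxB, hx', hxB', hobs⟩ := exists_obsAgree_of_absorbing hf
    (fun x x' ↦ (hκ x x').trans_lt (sub_lt_self _ (Real.exp_pos _))) hπ hBs hcon.1 hcon.2
    (p + 1) hns
  have hlim := hx.sub hx'
  have hbound := le_of_tendsto hlim (Eventually.of_forall fun i ↦
    iterate_transitionOp_sub_le hf hc hcontr hr hr₁ hcr hδ hκ (hψ (ns i)) (hψ₁ (ns i))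
      (fun z z' hz ↦ by
        have := hEN (ns i) z z' hz
        by_cases h : z' ∈ E (ns i) <;> simp [ψ, h, this])
      (N (ns i)) le_rfl (by omega) hobs (intensityClose_sum hr hr₁ x x'))
  simp only [φ, Set.indicator_of_mem hxB, Set.indicator_of_notMem hxB', Pi.one_apply] at hbound
  linarith [Real.exp_pos (-δ * ((∑ j ∈ Finset.range (q + 1), |(x j).2 - (x' j).2|)
    * (r / (1 - r))))]

end Coupling

section PathSpace

/-- The sequence of observations of a path. -/
def pathObs (z : ℤ → ℝ × ℝ) : ℤ → ℝ := fun t ↦ (z t).1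

/-- The history of a path before time `t`. -/
def pastAt (t : ℤ) (z : ℤ → ℝ × ℝ) : ℕ → ℝ × ℝ := fun i ↦ z (t - 1 - i)

/-- The path shifted by `k`. -/
def pathShift (k : ℤ) (z : ℤ → ℝ × ℝ) : ℤ → ℝ × ℝ := fun t ↦ z (t + k)

theorem measurable_pathObs : Measurable pathObs := by unfold pathObs; fun_prop

theorem measurable_pastAt (t : ℤ) : Measurable (pastAt t) := by unfold pastAt; fun_prop

theorem pastAt_pathShift (t k : ℤ) (z : ℤ → ℝ × ℝ) :
    pastAt t (pathShift k z) = pastAt (t + k) z := by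
  funext i
  simp only [pastAt, pathShift]
  congr 1
  ring

theorem pathShift_zero (z : ℤ → ℝ × ℝ) : pathShift 0 z = z := by
  funext t
  simp [pathShift]

theorem pathShift_pathShift (k l : ℤ) (z : ℤ → ℝ × ℝ) :
    pathShift k (pathShift l z) = pathShift (k + l) z := by
  funext t
  simp only [pathShift, add_assoc]

theorem preimage_pathShift_neg_natCast {s : Set (ℤ → ℝ × ℝ)} (hs : pathShift 1 ⁻¹' s = s) (n : ℕ) :
    pathShift (-n) ⁻¹' s = s := by
  induction n with
  | zero =>
    ext z
    simp [pathShift_zero]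
  | succ n ih =>
    conv_rhs => rw [← ih]
    conv_lhs => rw [← hs]
    ext z
    simp [pathShift_pathShift]

variable {p q : ℕ} (f : (Fin (p + 1) → ℝ) → (Fin (q + 1) → ℝ) → ℝ)

/-- The history at time `s + n` reconstructed from the observations `y`, when all the intensities
before time `s` are set to `0`. -/
def approxHistory (y : ℤ → ℝ) (s : ℤ) : ℕ → ℕ → ℝ × ℝ
  | 0 => fun i ↦ (y (s - 1 - i), 0)
  | n + 1 => historyStep f (approxHistory y s n) (y (s + n))

variable {f}

theorem measurable_approxHistory (hf : Measurable (Function.uncurry f)) (s : ℤ) (n : ℕ) :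
    Measurable fun y ↦ approxHistory f y s n := by
  induction n with
  | zero => unfold approxHistory; fun_prop
  | succ n ih => exact (measurable_historyStep hf).comp (ih.prodMk (measurable_pi_apply _))

theorem historyStep_pastAt {z : ℤ → ℝ × ℝ} {t : ℤ}
    (hz : (z t).2 = nextIntensity f (pastAt t z)) :
    historyStep f (pastAt t z) (z t).1 = pastAt (t + 1) z := by
  funext i
  cases i with
  | zero => simp [historyStep, pastAt, ← hz]
  | succ i =>
    simp only [historyStep, pastAt]
    congr 1
    push_cast
    ring

theorem abs_nextIntensity_approxHistory_sub_le {c : Fin (q + 1) → ℝ} {r : ℝ}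
    (hc : ∀ i, 0 ≤ c i)
    (hcontr : ∀ (y : Fin (p + 1) → ℝ) (z z' : Fin (q + 1) → ℝ),
      |f y z - f y z'| ≤ ∑ i, c i * |z i - z' i|)
    (hr : 0 < r) (hr₁ : r < 1) (hcr : ∑ i, c i ≤ r ^ (q + 1)) {z : ℤ → ℝ × ℝ}
    (hz : ∀ t, (z t).2 = nextIntensity f (pastAt t z)) (s : ℤ) (n : ℕ) :
    |nextIntensity f (approxHistory f (pathObs z) s n) - (z (s + n)).2|
      ≤ r ^ (n + 1) * ∑ j ∈ Finset.range (q + 1), |(pastAt s z j).2| := by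
  have key : (∀ k, ObsAgree k (approxHistory f (pathObs z) s n) (pastAt (s + n) z)) ∧
      IntensityClose q r (r ^ n * ∑ j ∈ Finset.range (q + 1), |(pastAt s z j).2|)
        (approxHistory f (pathObs z) s n) (pastAt (s + n) z) := by
    induction n with
    | zero =>
      refine ⟨fun k i _ ↦ by simp [approxHistory, pastAt, pathObs], ?_⟩
      simpa [approxHistory] using
        intensityClose_sum (q := q) hr hr₁ (approxHistory f (pathObs z) s 0) (pastAt s z)
    | succ n ih =>
      have hstep : pastAt (s + (n + 1 : ℕ)) z
          = historyStep f (pastAt (s + n) z) (pathObs z (s + n)) := by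
        rw [pathObs, historyStep_pastAt (hz _)]
        congr 1
        push_cast
        ring
      rw [hstep]
      refine ⟨fun k ↦ ((ih.1 k).historyStep _).mono k.le_succ, ?_⟩
      rw [pow_succ', mul_assoc]
      exact ih.2.historyStep hc hcontr hr hr₁ hcr (ih.1 _) _ _
  rw [hz (s + n), pow_succ', mul_assoc]
  exact abs_nextIntensity_sub_le hc hcontr hr hr₁ hcr (key.1 _) key.2

variable {μ : Measure (ℤ → ℝ × ℝ)}

theorem ae_forall_eq_nextIntensity (hshift : ∀ k, MeasurePreserving (pathShift k) μ μ)
    (hmodel : ∀ᵐ z ∂μ, (z 0).2 = nextIntensity f (pastAt 0 z)) :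
    ∀ᵐ z ∂μ, ∀ t, (z t).2 = nextIntensity f (pastAt t z) := by
  refine ae_all_iff.2 fun t ↦ ?_
  filter_upwards [(hshift t).quasiMeasurePreserving.ae hmodel] with z hz
  simpa [pastAt_pathShift, pathShift] using hz

/-- An event which can be approximated by past events is determined by the past. -/
theorem exists_ae_eq_preimage_pastAt {s : Set (ℤ → ℝ × ℝ)}
    (happrox : ∀ ε : ℝ≥0∞, 0 < ε → ∃ E : Set (ℕ → ℝ × ℝ), MeasurableSet E ∧
      μ ((pastAt 0 ⁻¹' E) ∆ s) < ε) :
    ∃ B : Set (ℕ → ℝ × ℝ), MeasurableSet B ∧ (pastAt 0 ⁻¹' B : Set _) =ᵐ[μ] s := by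
  choose E hE hEε using fun n : ℕ ↦ happrox (2⁻¹ ^ n) (ENNReal.pow_pos (by simp) n)
  have hsum : ∑' n, μ ((pastAt 0 ⁻¹' E n) ∆ s) ≠ ⊤ :=
    ne_top_of_le_ne_top (by simp [ENNReal.tsum_geometric]) (ENNReal.tsum_le_tsum fun n ↦ (hEε n).le)
  refine ⟨liminf E atTop, .measurableSet_liminf hE, ?_⟩
  filter_upwards [ae_eventually_notMem hsum] with z hz
  refine propext ?_
  change pastAt 0 z ∈ liminf E atTop ↔ z ∈ s
  rw [mem_liminf_iff_eventually_mem]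
  have hiff : ∀ᶠ n in atTop, pastAt 0 z ∈ E n ↔ z ∈ s := by
    filter_upwards [hz] with n hn
    simp only [Set.mem_symmDiff, Set.mem_preimage] at hn
    tauto
  rw [eventually_congr hiff, eventually_const]

variable [IsProbabilityMeasure μ]

/-- In a stationary model the intensities are functions of the observations. -/
theorem exists_measurable_intensity (hf : Measurable (Function.uncurry f))
    {c : Fin (q + 1) → ℝ} (hc : ∀ i, 0 ≤ c i) (hcsum : ∑ i, c i < 1)
    (hcontr : ∀ (y : Fin (p + 1) → ℝ) (z z' : Fin (q + 1) → ℝ),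
      |f y z - f y z'| ≤ ∑ i, c i * |z i - z' i|)
    (hshift : ∀ k, MeasurePreserving (pathShift k) μ μ)
    (hmodel : ∀ᵐ z ∂μ, (z 0).2 = nextIntensity f (pastAt 0 z)) :
    ∃ Λ : (ℤ → ℝ) → ℝ, Measurable Λ ∧ ∀ᵐ z ∂μ, (z 0).2 = Λ (pathObs z) := by
  obtain ⟨r, hr, hr₁, hcr⟩ := exists_rate_of_sum_lt_one hcsum hc
  set L : ℕ → (ℤ → ℝ) → ℝ := fun n y ↦ nextIntensity f (approxHistory f y (-n) n)
  have hL (n) : Measurable (L n) :=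
    (measurable_nextIntensity hf).comp (measurable_approxHistory hf _ _)
  set W : (ℤ → ℝ × ℝ) → ℝ := fun z ↦ ∑ j ∈ Finset.range (q + 1), |(pastAt 0 z j).2|
  have hW : Measurable W := by
    simp only [W, pastAt]
    fun_prop
  have hW₀ (z) : 0 ≤ W z := Finset.sum_nonneg fun _ _ ↦ abs_nonneg _
  have hWlim : TendstoInMeasure μ (fun (n : ℕ) z ↦ r ^ (n + 1) * W z) atTop fun _ ↦ 0 := by
    refine tendstoInMeasure_of_tendsto_ae
      (fun n ↦ (hW.const_mul _).aestronglyMeasurable) (ae_of_all _ fun z ↦ ?_)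
    simpa using ((tendsto_pow_atTop_nhds_zero_of_lt_one hr.le hr₁).comp
      (tendsto_add_atTop_nat 1)).mul_const (W z)
  have hlim : TendstoInMeasure μ (fun n z ↦ L n (pathObs z)) atTop fun z ↦ (z 0).2 := by
    rw [tendstoInMeasure_iff_dist] at hWlim ⊢
    intro ε hε
    refine tendsto_of_tendsto_of_tendsto_of_le_of_le tendsto_const_nhds (hWlim ε hε)
      (fun _ ↦ zero_le) fun n ↦ ?_
    have hm : MeasurableSet {z | ε ≤ dist (r ^ (n + 1) * W z) 0} :=
      measurableSet_le measurable_const ((hW.const_mul _).dist measurable_const)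
    change μ _ ≤ μ _
    rw [← (hshift (-n)).measure_preimage hm.nullMeasurableSet]
    refine measure_mono_ae ?_
    filter_upwards [ae_forall_eq_nextIntensity hshift hmodel] with z hz hεz
    change ε ≤ dist (r ^ (n + 1) * W (pathShift (-n) z)) 0
    have h := abs_nextIntensity_approxHistory_sub_le hc hcontr hr hr₁ hcr hz (-n) n
    rw [neg_add_cancel] at h
    rw [dist_zero_right, Real.norm_of_nonneg (mul_nonneg (by positivity) (hW₀ _))]
    simp only [W, pastAt_pathShift, zero_add]
    exact le_trans hεz h
  obtain ⟨ns, -, hns⟩ := hlim.exists_seq_tendsto_ae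
  refine ⟨fun y ↦ limsup (fun i ↦ L (ns i) y) atTop, .limsup fun i ↦ hL _, ?_⟩
  filter_upwards [hns] with z hz
  exact hz.limsup_eq.symm

/-- In a stationary model an invariant event can be approximated by events depending on finitely
many past observations. -/
theorem exists_approx_of_invariant (hf : Measurable (Function.uncurry f))
    {c : Fin (q + 1) → ℝ} (hc : ∀ i, 0 ≤ c i) (hcsum : ∑ i, c i < 1)
    (hcontr : ∀ (y : Fin (p + 1) → ℝ) (z z' : Fin (q + 1) → ℝ),
      |f y z - f y z'| ≤ ∑ i, c i * |z i - z' i|)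
    (hshift : ∀ k, MeasurePreserving (pathShift k) μ μ)
    (hmodel : ∀ᵐ z ∂μ, (z 0).2 = nextIntensity f (pastAt 0 z)) {s : Set (ℤ → ℝ × ℝ)}
    (hsm : MeasurableSet s) (hs : pathShift 1 ⁻¹' s = s) {ε : ℝ≥0∞} (hε : 0 < ε) :
    ∃ (E : Set (ℕ → ℝ × ℝ)) (N : ℕ), MeasurableSet E ∧
      (∀ x x', ObsAgree N x x' → (x ∈ E ↔ x' ∈ E)) ∧ μ ((pastAt 0 ⁻¹' E) ∆ s) < ε := by
  obtain ⟨Λ, hΛ, hΛ₁⟩ := exists_measurable_intensity hf hc hcsum hcontr hshift hmodel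
  set R : (ℤ → ℝ) → ℤ → ℝ × ℝ := fun y t ↦ (y t, Λ fun u ↦ y (u + t))
  have hR : Measurable R := measurable_pi_lambda _ fun t ↦
    (measurable_pi_apply t).prodMk (hΛ.comp (by fun_prop))
  have hRz : ∀ᵐ z ∂μ, R (pathObs z) = z := by
    have hall : ∀ᵐ z ∂μ, ∀ t, (pathShift t z 0).2 = Λ (pathObs (pathShift t z)) :=
      ae_all_iff.2 fun t ↦ (hshift t).quasiMeasurePreserving.ae hΛ₁
    filter_upwards [hall] with z hz
    funext t
    have := hz t
    simp only [pathShift, zero_add] at this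
    exact Prod.ext rfl this.symm
  have hsR : (pathObs ⁻¹' (R ⁻¹' s) : Set _) =ᵐ[μ] s := by
    filter_upwards [hRz] with z hz
    refine propext ?_
    change R (pathObs z) ∈ s ↔ z ∈ s
    rw [hz]
  have : IsProbabilityMeasure (μ.map pathObs) :=
    Measure.isProbabilityMeasure_map measurable_pathObs.aemeasurable
  have hmin : min ε 1 ≠ ⊤ := (min_le_right _ _).trans_lt ENNReal.one_lt_top |>.ne
  obtain ⟨D, hD, hDε⟩ := (Measure.MeasureDense.of_generateFrom_isSetAlgebra_finite
    (μ.map pathObs) isSetAlgebra_measurableCylinders generateFrom_measurableCylinders.symm).approx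
    (R ⁻¹' s) (hR hsm) (measure_ne_top _ _) (min ε 1).toReal
    (ENNReal.toReal_pos (lt_min hε one_pos).ne' hmin)
  rw [ENNReal.ofReal_toReal hmin] at hDε
  have hDm : MeasurableSet D := .of_mem_measurableCylinders hD
  obtain ⟨I, D₀, -, rfl⟩ := (mem_measurableCylinders D).1 hD
  set K := I.sup Int.natAbs
  have hK {i : ℤ} (hi : i ∈ I) : i.natAbs ≤ K := Finset.le_sup (f := Int.natAbs) hi
  set ext : (ℕ → ℝ × ℝ) → ℤ → ℝ := fun x i ↦ (x (K - i).toNat).1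
  have hext : Measurable ext := by
    simp only [ext]
    fun_prop
  have hcyl {y y' : ℤ → ℝ} (h : ∀ i ∈ I, y i = y' i) :
      y ∈ cylinder I D₀ ↔ y' ∈ cylinder I D₀ := by
    rw [mem_cylinder, mem_cylinder]
    refine iff_of_eq (congrArg (· ∈ D₀) (funext fun i ↦ h i i.2))
  refine ⟨ext ⁻¹' cylinder I D₀, 2 * K + 1, hext hDm, fun x x' hx ↦ hcyl fun i hi ↦ ?_, ?_⟩
  · have := hK hi
    exact hx _ (by omega)
  have hpre : pastAt 0 ⁻¹' (ext ⁻¹' cylinder I D₀)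
      = pathShift (-(K + 1 : ℕ)) ⁻¹' (pathObs ⁻¹' cylinder I D₀) := by
    ext z
    refine hcyl fun i hi ↦ ?_
    have := hK hi
    simp only [ext, pastAt, pathObs, pathShift]
    congr 2
    push_cast
    omega
  have hDs := (measurable_pathObs hDm).symmDiff hsm
  calc μ ((pastAt 0 ⁻¹' (ext ⁻¹' cylinder I D₀)) ∆ s)
      = μ (pathShift (-(K + 1 : ℕ)) ⁻¹' ((pathObs ⁻¹' cylinder I D₀) ∆ s)) := by
        rw [hpre, Set.preimage_symmDiff, preimage_pathShift_neg_natCast hs]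
    _ = μ ((pathObs ⁻¹' cylinder I D₀) ∆ s) :=
        (hshift _).measure_preimage hDs.nullMeasurableSet
    _ = μ ((pathObs ⁻¹' cylinder I D₀) ∆ (pathObs ⁻¹' (R ⁻¹' s))) :=
        measure_congr ((ae_eq_refl _).symmDiff hsR.symm)
    _ = μ.map pathObs ((R ⁻¹' s) ∆ cylinder I D₀) := by
        rw [Measure.map_apply measurable_pathObs ((hR hsm).symmDiff hDm), Set.preimage_symmDiff,
          symmDiff_comm]
    _ < ε := hDε.trans_le (min_le_left _ _)

theorem ergodic_pathShift (hf : Measurable (Function.uncurry f))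
    {c : Fin (q + 1) → ℝ} (hc : ∀ i, 0 ≤ c i) (hcsum : ∑ i, c i < 1)
    (hcontr : ∀ (y : Fin (p + 1) → ℝ) (z z' : Fin (q + 1) → ℝ),
      |f y z - f y z'| ≤ ∑ i, c i * |z i - z' i|)
    {κ : Kernel (ℕ → ℝ × ℝ) ℝ} [IsMarkovKernel κ] {δ : ℝ} (hδ : 0 < δ)
    (hκ : ∀ x x', tvDist (κ x) (κ x')
      ≤ 1 - Real.exp (-δ * |nextIntensity f x - nextIntensity f x'|))
    (hshift : ∀ k, MeasurePreserving (pathShift k) μ μ)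
    (hmodel : ∀ᵐ z ∂μ, (z 0).2 = nextIntensity f (pastAt 0 z))
    (hlaw : μ.map (fun z ↦ (pastAt 0 z, (z 0).1)) = μ.map (pastAt 0) ⊗ₘ κ) :
    Ergodic (pathShift 1) μ := by
  refine { hshift 1 with aeconst_set := fun s hsm hs ↦ ?_ }
  have happrox (ε : ℝ≥0∞) (hε : 0 < ε) :=
    exists_approx_of_invariant hf hc hcsum hcontr hshift hmodel hsm hs hε
  obtain ⟨B, hBm, hB⟩ := exists_ae_eq_preimage_pastAt fun ε hε ↦
    let ⟨E, _, hE, _, h⟩ := happrox ε hε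
    ⟨E, hE, h⟩
  have hpast := measurable_pastAt 0
  have hpair : Measurable fun z : ℤ → ℝ × ℝ ↦ (pastAt 0 z, (z 0).1) :=
    hpast.prodMk (measurable_pi_apply 0).fst
  have hstep := measurable_historyStep hf
  have : IsProbabilityMeasure (μ.map (pastAt 0)) :=
    Measure.isProbabilityMeasure_map hpast.aemeasurable
  have hnext : ∀ᵐ z ∂μ, historyStep f (pastAt 0 z) (z 0).1 = pastAt 0 (pathShift 1 z) := by
    filter_upwards [hmodel] with z hz
    rw [historyStep_pastAt hz, pastAt_pathShift]
  have hπ : (μ.map (pastAt 0) ⊗ₘ κ).map (Function.uncurry (historyStep f)) = μ.map (pastAt 0) := by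
    have hnext' : (Function.uncurry (historyStep f) ∘ fun z ↦ (pastAt 0 z, (z 0).1))
        =ᵐ[μ] pastAt 0 ∘ pathShift 1 := hnext
    rw [← hlaw, Measure.map_map hstep hpair, Measure.map_congr hnext',
      ← Measure.map_map hpast (hshift 1).measurable, (hshift 1).map_eq]
  have hBs : ∀ᵐ x ∂μ.map (pastAt 0), ∀ᵐ y ∂κ x, historyStep f x y ∈ B ↔ x ∈ B := by
    refine Measure.ae_ae_of_ae_compProd
      (p := fun w ↦ Function.uncurry (historyStep f) w ∈ B ↔ w.1 ∈ B) ?_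
    rw [← hlaw, ae_map_iff hpair.aemeasurable ((hstep hBm).iff (measurable_fst hBm))]
    filter_upwards [hnext, hB.mem_iff, (hshift 1).quasiMeasurePreserving.ae hB.mem_iff]
      with z hz h₁ h₂
    rw [Function.uncurry_apply_pair, hz]
    have h₃ : pathShift 1 z ∈ s ↔ z ∈ s := by
      conv_rhs => rw [← hs]
      rfl
    exact h₂.trans (h₃.trans h₁.symm)
  have htriv := measure_eq_zero_or_compl_of_absorbing hf hc hcsum hcontr hδ hκ hπ hBm hBs
    fun ε hε ↦ by
      obtain ⟨E, N, hE, hEN, hEε⟩ := happrox ε hε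
      refine ⟨E, N, hE, hEN, ?_⟩
      rwa [Measure.map_apply hpast (hE.symmDiff hBm), Set.preimage_symmDiff,
        measure_congr ((ae_eq_refl _).symmDiff hB)]
  rw [Measure.map_apply hpast hBm, Measure.map_apply hpast hBm.compl, Set.preimage_compl,
    measure_congr hB, measure_congr hB.compl] at htriv
  rw [eventuallyConst_set]
  exact htriv.symm.imp id measure_eq_zero_iff_ae_notMem.1

end PathSpace

end History

section Model

variable {Ω : Type*} {m mΩ : MeasurableSpace Ω} {P : Measure Ω} [IsProbabilityMeasure P]

/-- The conditional law of `Y` given `m` determines its joint law with any `m`-measurable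
variable `X`. -/
theorem map_prodMk_eq_compProd_of_condExp {H S : Type*} [MeasurableSpace H] [MeasurableSpace S]
    {κ : Kernel H S} [IsMarkovKernel κ] (hm : m ≤ mΩ) {X : Ω → H} {Y : Ω → S}
    (hX : Measurable[m] X) (hY : Measurable Y)
    (hcond : ∀ A, MeasurableSet A →
      P[(Y ⁻¹' A).indicator (fun _ ↦ (1 : ℝ)) | m] =ᵐ[P] fun ω ↦ (κ (X ω) A).toReal) :
    P.map (fun ω ↦ (X ω, Y ω)) = P.map X ⊗ₘ κ := by
  have hX' : Measurable X := hX.mono hm le_rfl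
  have : IsProbabilityMeasure (P.map X) := Measure.isProbabilityMeasure_map hX'.aemeasurable
  have : IsProbabilityMeasure (P.map fun ω ↦ (X ω, Y ω)) :=
    Measure.isProbabilityMeasure_map (hX'.prodMk hY).aemeasurable
  refine Measure.ext_prod fun {s t} hs ht ↦ ?_
  have hκt : Measurable fun x ↦ κ x t := κ.measurable_coe ht
  rw [Measure.compProd_apply_prod hs ht, setLIntegral_map hs hκt hX',
    Measure.map_apply (hX'.prodMk hY) (hs.prod ht), Set.mk_preimage_prod]
  have hreal : ∫ ω in X ⁻¹' s, (κ (X ω) t).toReal ∂P = P.real (X ⁻¹' s ∩ Y ⁻¹' t) := by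
    rw [← setIntegral_congr_ae (g := fun ω ↦ (κ (X ω) t).toReal) (hX' hs)
        ((hcond t ht).mono fun ω h _ ↦ h),
      setIntegral_condExp hm ((integrable_const _).indicator (hY ht)) (hX hs),
      integral_indicator (hY ht), Measure.restrict_restrict (hY ht), Set.inter_comm]
    simp [measureReal_def]
  rw [integral_toReal (f := fun ω ↦ κ (X ω) t) (hκt.comp hX').aemeasurable
    (ae_of_all _ fun ω ↦ measure_lt_top _ _), measureReal_def] at hreal
  refine ((ENNReal.toReal_eq_toReal_iff' ?_ (measure_ne_top _ _)).1 hreal).symm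
  exact ((lintegral_mono fun ω ↦ prob_le_one).trans_lt (by simp)).ne

end Model

/-- under (A1), (A2), (A3), a strictly stationary version of the bivariate
process `((Y_t, λ_t))_{t∈ℤ}` is ergodic: the two-sided shift on path space is an ergodic
measure-preserving transformation for the law of the process. -/
theorem stmt_4
    {Ω : Type*} [MeasurableSpace Ω] (P : Measure Ω) [IsProbabilityMeasure P]
    (p q : ℕ)
    (Q : ℝ → Measure ℝ) (hQprob : ∀ l, IsProbabilityMeasure (Q l))
    (hQmeas : ∀ A : Set ℝ, MeasurableSet A → Measurable fun l => Q l A)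
    (hQsupp : ∀ l, Q l (Set.Iio 0) = 0)
    (f : (Fin (p + 1) → ℝ) → (Fin (q + 1) → ℝ) → ℝ)
    (hf : Measurable (Function.uncurry f)) (hfpos : ∀ y z, 0 ≤ f y z)
    (Y lam : ℤ → Ω → ℝ)
    (hYmeas : ∀ t, Measurable (Y t)) (hlammeas : ∀ t, Measurable (lam t))
    (hYpos : ∀ t, ∀ᵐ ω ∂P, 0 ≤ Y t ω) (hlampos : ∀ t, ∀ᵐ ω ∂P, 0 ≤ lam t ω)
    (F : ℤ → MeasurableSpace Ω)
    (hF : ∀ s : ℤ, F s = ⨆ u : {u : ℤ // u ≤ s},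
      MeasurableSpace.comap (fun ω => (Y u ω, lam u ω)) inferInstance)
    (hmodel : ∀ t : ℤ, ∀ᵐ ω ∂P,
      lam t ω = f (fun i => Y (t - 1 - (i : ℕ)) ω) (fun j => lam (t - 1 - (j : ℕ)) ω))
    (hcond : ∀ (t : ℤ) (A : Set ℝ), MeasurableSet A →
      (P[(Y t ⁻¹' A).indicator (fun _ => (1 : ℝ)) | F (t - 1)])
        =ᵐ[P] fun ω => (Q (lam t ω) A).toReal)
    -- strict stationarity of ((Y_t, λ_t))_{t ∈ ℤ}
    (hstat : ∀ k : ℤ,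
      Measure.map (fun ω => fun t : ℤ => (Y (t + k) ω, lam (t + k) ω)) P
        = Measure.map (fun ω => fun t : ℤ => (Y t ω, lam t ω)) P)
    -- (A1) geometric drift condition
    (a : Fin p → ℝ) (b : Fin (q + 1) → ℝ) (κ a0 : ℝ)
    (ha : ∀ i, 0 < a i) (hb : ∀ j, 0 < b j) (hκ : κ ∈ Set.Ioo (0 : ℝ) 1) (ha0 : 0 ≤ a0)
    (hdrift : ∀ t : ℤ, ∀ᵐ ω ∂P,
      (P[fun ω => (∑ i : Fin p, a i * Y (t - 1 - (i : ℕ)) ω)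
          + ∑ j : Fin (q + 1), b j * lam (t - (j : ℕ)) ω | F (t - 1)]) ω
        ≤ κ * ((∑ i : Fin p, a i * Y (t - 2 - (i : ℕ)) ω)
          + ∑ j : Fin (q + 1), b j * lam (t - 1 - (j : ℕ)) ω) + a0)
    -- (A2) semi-contractive condition
    (c : Fin (q + 1) → ℝ) (hc : ∀ i, 0 ≤ c i) (hcsum : ∑ i, c i < 1)
    (hcontr : ∀ (y : Fin (p + 1) → ℝ) (z z' : Fin (q + 1) → ℝ),
      |f y z - f y z'| ≤ ∑ i, c i * |z i - z' i|)
    -- (A3) similarity condition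
    (δ : ℝ) (hδ : 0 < δ)
    (hsim : ∀ l l' : ℝ, 0 ≤ l → 0 ≤ l' →
      tvDist (Q l) (Q l') ≤ 1 - Real.exp (-δ * |l - l'|)) :
    Ergodic (fun x : ℤ → ℝ × ℝ => fun t => x (t + 1))
      (Measure.map (fun ω => fun t : ℤ => (Y t ω, lam t ω)) P) := by
  set Z : Ω → ℤ → ℝ × ℝ := fun ω t ↦ (Y t ω, lam t ω)
  have hZ : Measurable Z := measurable_pi_lambda _ fun t ↦ (hYmeas t).prodMk (hlammeas t)
  have : IsProbabilityMeasure (P.map Z) := Measure.isProbabilityMeasure_map hZ.aemeasurable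
  let Qk : Kernel ℝ ℝ := ⟨Q, Measure.measurable_of_measurable_coe _ hQmeas⟩
  have : IsMarkovKernel Qk := ⟨hQprob⟩
  let κ' : Kernel (ℕ → ℝ × ℝ) ℝ := Qk.comap (nextIntensity f) (measurable_nextIntensity hf)
  have hmeasShift (k : ℤ) : Measurable (pathShift k) := by
    unfold pathShift
    fun_prop
  have hmodel₀ : ∀ᵐ ω ∂P, lam 0 ω = nextIntensity f (pastAt 0 (Z ω)) := hmodel 0
  have hFle : F (0 - 1) ≤ ‹MeasurableSpace Ω› := by
    rw [hF]
    exact iSup_le fun u ↦ ((hYmeas u).prodMk (hlammeas u)).comap_le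
  have hpastF : Measurable[F (0 - 1)] fun ω ↦ pastAt 0 (Z ω) := by
    refine @measurable_pi_lambda _ _ _ (F (0 - 1)) _ _ fun i ↦ ?_
    rw [measurable_iff_comap_le, hF]
    exact le_iSup (fun u : {u : ℤ // u ≤ 0 - 1} ↦
      MeasurableSpace.comap (fun ω ↦ (Y u ω, lam u ω)) inferInstance) ⟨0 - 1 - i, by omega⟩
  refine ergodic_pathShift (κ := κ') hf hc hcsum hcontr hδ
    (fun x x' ↦ hsim _ _ (hfpos _ _) (hfpos _ _))
    (fun k ↦ ⟨hmeasShift k, (Measure.map_map (hmeasShift k) hZ).trans (hstat k)⟩) ?_ ?_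
  · exact (ae_map_iff hZ.aemeasurable (measurableSet_eq_fun (measurable_pi_apply 0).snd
      ((measurable_nextIntensity hf).comp (measurable_pastAt 0)))).2 hmodel₀
  · rw [Measure.map_map ((measurable_pastAt 0).prodMk (measurable_pi_apply 0).fst) hZ,
      Measure.map_map (measurable_pastAt 0) hZ]
    refine map_prodMk_eq_compProd_of_condExp hFle hpastF (hYmeas 0) fun A hA ↦ ?_
    filter_upwards [hcond 0 A hA, hmodel₀] with ω h₁ h₂
    rw [h₁, h₂]
    rfl
end

section
/- Let (W_t)_{t∈ℕ₀} be a nonnegative integrable process adapted to a filtration (G_t)_{t∈ℕ₀} on a probability space, satisfying the drift inequality E(W_t | G_{t−1}) ≤ κ W_{t−1} + a_0 a.s. for all t ≥ 1, where κ ∈ (0,1) and a_0 ∈ [0,∞). Set η = 2/(1+κ), C₁ = (2a_0 + 2)/(1−κ), and let τ₁ = inf{t ≥ 0 : W_t ≤ C₁} be the first hitting time of [0,C₁]. Then, a.s. on the event {W_0 > C₁}, E(η^{τ₁} | G_0) ≤ W_0. -/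
open MeasureTheory
open scoped Classical

/-- One step of the drift: on an event `S ∈ m` where `W` exceeds the threshold, the mean of the
next value `W'` contracts by the factor `(1 + κ) / 2`, with `P S` to spare. -/
lemma setIntegral_le_of_condExp_drift {Ω : Type*} {m m0 : MeasurableSpace Ω} {P : Measure Ω}
    [IsFiniteMeasure P] (hm : m ≤ m0) {W W' : Ω → ℝ} (hW : Integrable W P)
    (hW' : Integrable W' P) {κ a : ℝ} (hκ : κ < 1)
    (hdrift : ∀ᵐ ω ∂P, (P[W' | m]) ω ≤ κ * W ω + a)
    {S : Set Ω} (hS : MeasurableSet[m] S) (hSW : ∀ ω ∈ S, (2 * a + 2) / (1 - κ) < W ω) :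
    ∫ ω in S, W' ω ∂P ≤ (1 + κ) / 2 * ∫ ω in S, W ω ∂P - P.real S := by
  have hle : ∀ᵐ ω ∂P, ω ∈ S → (P[W' | m]) ω ≤ (1 + κ) / 2 * W ω - 1 := by
    filter_upwards [hdrift] with ω hω hωS
    have hlt := (div_lt_iff₀ (by linarith)).1 (hSW ω hωS)
    linarith
  calc ∫ ω in S, W' ω ∂P = ∫ ω in S, (P[W' | m]) ω ∂P := (setIntegral_condExp hm hW' hS).symm
    _ ≤ ∫ ω in S, ((1 + κ) / 2 * W ω - 1) ∂P :=
        setIntegral_mono_on_ae integrable_condExp.integrableOn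
          ((hW.const_mul _).sub (integrable_const 1)).integrableOn (hm S hS) hle
    _ = (1 + κ) / 2 * ∫ ω in S, W ω ∂P - P.real S := by
        rw [integral_sub (hW.const_mul _).integrableOn (integrable_const 1), integral_const_mul]
        simp

/-- If a nonnegative sequence satisfies `v (t + 1) + p t ≤ v t`, then the series of the
nonnegative terms `p` is at most `v 0`. -/
lemma tsum_ofReal_le_of_add_le {v p : ℕ → ℝ} (hv : ∀ t, 0 ≤ v t) (hp : ∀ t, 0 ≤ p t)
    (hstep : ∀ t, v (t + 1) + p t ≤ v t) : ∑' t, ENNReal.ofReal (p t) ≤ ENNReal.ofReal (v 0) := by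
  have hsum : ∀ n, ∑ t ∈ Finset.range n, p t + v n ≤ v 0 := by
    intro n
    induction n with
    | zero => simp
    | succ n ih =>
      rw [Finset.sum_range_succ]
      linarith [hstep n]
  refine ENNReal.tsum_le_of_sum_range_le fun n => ?_
  rw [← ENNReal.ofReal_sum_of_nonneg fun t _ => hp t]
  exact ENNReal.ofReal_le_ofReal (by linarith [hsum n, hv n])

/-- Pointwise, `η ^ τ` is at most the sum of `η ^ (t + 1)` over the times `t < τ`, where `τ ≥ 1`
is the first time the path `w` is at most `c`. -/
lemma pow_hittingTime_le_tsum {w : ℕ → ℝ} {c η : ℝ} (hη : 1 ≤ η) (h0 : c < w 0) :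
    (if h : ∃ t, w t ≤ c then ENNReal.ofReal (η ^ (Nat.find h)) else ⊤) ≤
      ∑' t, if ∀ s ≤ t, c < w s then ENNReal.ofReal (η ^ (t + 1)) else 0 := by
  split_ifs with h
  · obtain ⟨k, hk⟩ : ∃ k, Nat.find h = k + 1 := by
      refine Nat.exists_eq_succ_of_ne_zero fun hz => ?_
      have hle := Nat.find_spec h
      rw [hz] at hle
      exact hle.not_gt h0
    have hlt : ∀ s ≤ k, c < w s := fun s hs => not_le.1 (Nat.find_min h (by omega))
    rw [hk]
    refine le_trans ?_ (ENNReal.le_tsum k)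
    rw [if_pos hlt]
  · push Not at h
    have htop : ∑' _ : ℕ, (1 : ENNReal) = ⊤ := ENNReal.tsum_const_eq_top_of_ne_zero one_ne_zero
    rw [← htop]
    refine ENNReal.tsum_le_tsum fun t => ?_
    rw [if_pos fun s _ => h s]
    exact ENNReal.one_le_ofReal.2 (one_le_pow₀ hη)

/-- for a nonnegative adapted integrable process `(W_t)` with drift
`E(W_t | G_{t−1}) ≤ κ W_{t−1} + a_0`, `η = 2/(1+κ)`, `C₁ = (2a₀+2)/(1−κ)` and
`τ₁ = inf{t ≥ 0 : W_t ≤ C₁}`, one has `E(η^{τ₁} | G_0) ≤ W_0` a.s. on `{W_0 > C₁}`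
(with `η^{τ₁} = ∞` on `{τ₁ = ∞}`); formulated via the defining integral inequality of the
conditional expectation over sets `A ∈ G_0`. -/
theorem stmt_5 {Ω : Type*} {m0 : MeasurableSpace Ω} (P : Measure Ω) [IsProbabilityMeasure P]
    (G : ℕ → MeasurableSpace Ω) (hGle : ∀ t, G t ≤ m0) (hGmono : Monotone G)
    (W : ℕ → Ω → ℝ) (hadapt : ∀ t, Measurable[G t] (W t))
    (hpos : ∀ t ω, 0 ≤ W t ω) (hint : ∀ t, Integrable (W t) P)
    (κ a0 : ℝ) (hκ : κ ∈ Set.Ioo (0 : ℝ) 1) (ha0 : 0 ≤ a0)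
    (hdrift : ∀ t : ℕ, 1 ≤ t → ∀ᵐ ω ∂P, (P[W t | G (t - 1)]) ω ≤ κ * W (t - 1) ω + a0)
    (η C₁ : ℝ) (hη : η = 2 / (1 + κ)) (hC₁ : C₁ = (2 * a0 + 2) / (1 - κ)) :
    ∀ A : Set Ω, MeasurableSet[G 0] A →
      ∫⁻ ω in A ∩ {ω | C₁ < W 0 ω},
          (if h : ∃ t, W t ω ≤ C₁ then ENNReal.ofReal (η ^ (Nat.find h)) else ⊤) ∂P
        ≤ ∫⁻ ω in A ∩ {ω | C₁ < W 0 ω}, ENNReal.ofReal (W 0 ω) ∂P := by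
  intro A hA
  obtain ⟨hκ0, hκ1⟩ := hκ
  have hη1 : 1 ≤ η := by rw [hη, le_div_iff₀ (by linarith)]; linarith
  have hη0 : 0 ≤ η := zero_le_one.trans hη1
  have hηκ : η * ((1 + κ) / 2) = 1 := by rw [hη]; field_simp
  set S : ℕ → Set Ω := fun t => A ∩ {ω | ∀ s ≤ t, C₁ < W s ω} with hS
  have hSmeas : ∀ t, MeasurableSet[G t] (S t) := by
    intro t
    refine (hGmono (Nat.zero_le t) A hA).inter ?_
    simp only [Set.ofPred_forall]
    exact MeasurableSet.iInter fun s => MeasurableSet.iInter fun hs =>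
      hGmono hs _ (hadapt s measurableSet_Ioi)
  have hS0 : A ∩ {ω | C₁ < W 0 ω} = S 0 := by simp [hS]
  have hSanti : ∀ t, S (t + 1) ⊆ S t := fun t ω hω =>
    ⟨hω.1, fun s hs => hω.2 s (hs.trans t.le_succ)⟩
  have hstep : ∀ t, η ^ (t + 1) * ∫ ω in S (t + 1), W (t + 1) ω ∂P + η ^ (t + 1) * P.real (S t)
      ≤ η ^ t * ∫ ω in S t, W t ω ∂P := by
    intro t
    have hmono : ∫ ω in S (t + 1), W (t + 1) ω ∂P ≤ ∫ ω in S t, W (t + 1) ω ∂P :=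
      setIntegral_mono_set (hint _).integrableOn (ae_of_all _ (hpos _))
        (hSanti t).eventuallyLE
    have hdec := setIntegral_le_of_condExp_drift (hGle t) (hint t) (hint (t + 1)) hκ1
      (hdrift (t + 1) (Nat.le_add_left 1 t)) (hSmeas t)
      (fun ω hω => hC₁ ▸ hω.2 t le_rfl)
    calc η ^ (t + 1) * ∫ ω in S (t + 1), W (t + 1) ω ∂P + η ^ (t + 1) * P.real (S t)
        = η ^ (t + 1) * (∫ ω in S (t + 1), W (t + 1) ω ∂P + P.real (S t)) := by ring
      _ ≤ η ^ (t + 1) * ((1 + κ) / 2 * ∫ ω in S t, W t ω ∂P) := by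
          gcongr
          linarith
      _ = η ^ t * (η * ((1 + κ) / 2)) * ∫ ω in S t, W t ω ∂P := by ring
      _ = η ^ t * ∫ ω in S t, W t ω ∂P := by rw [hηκ, mul_one]
  have htsum := tsum_ofReal_le_of_add_le
    (v := fun t => η ^ t * ∫ ω in S t, W t ω ∂P) (p := fun t => η ^ (t + 1) * P.real (S t))
    (fun t => mul_nonneg (pow_nonneg hη0 t) (integral_nonneg (hpos t)))
    (fun t => by positivity) hstep
  have hSmeas0 : ∀ t, MeasurableSet (S t) := fun t => hGle t _ (hSmeas t)
  rw [hS0]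
  calc _ ≤ ∫⁻ ω in S 0, ∑' t, (S t).indicator (fun _ => ENNReal.ofReal (η ^ (t + 1))) ω ∂P := by
        refine setLIntegral_mono' (hSmeas0 0) fun ω hω => ?_
        refine (pow_hittingTime_le_tsum (w := fun t => W t ω) hη1 (hω.2 0 le_rfl)).trans_eq ?_
        refine tsum_congr fun t => ?_
        simp [hS, Set.indicator_apply, hω.1]
    _ ≤ ∫⁻ ω, ∑' t, (S t).indicator (fun _ => ENNReal.ofReal (η ^ (t + 1))) ω ∂P :=
        setLIntegral_le_lintegral _ _
    _ = ∑' t, ENNReal.ofReal (η ^ (t + 1) * P.real (S t)) := by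
        rw [lintegral_tsum fun t => (measurable_const.indicator (hSmeas0 t)).aemeasurable]
        refine tsum_congr fun t => ?_
        rw [lintegral_indicator_const (hSmeas0 t), ENNReal.ofReal_mul (by positivity),
          ofReal_measureReal]
    _ ≤ ENNReal.ofReal (∫ ω in S 0, W 0 ω ∂P) := by simpa using htsum
    _ = ∫⁻ ω in S 0, ENNReal.ofReal (W 0 ω) ∂P :=
        ofReal_integral_eq_lintegral_ofReal (hint 0).integrableOn (ae_of_all _ (hpos 0))
end

section
/- Let (W_t)_{t∈ℕ₀} be a nonnegative integrable process adapted to a filtration (G_t)_{t∈ℕ₀} on a probability space, satisfying the drift inequality E(W_t | G_{t−1}) ≤ κ W_{t−1} + a_0 a.s. for all t ≥ 1, where κ ∈ (0,1) and a_0 ∈ [0,∞). Set η = 2/(1+κ) and C₁ = (2a_0 + 2)/(1−κ). Suppose W_0 ≤ C₁ a.s., let D ∈ ℕ, and define the retarded return time τ' = inf{t ≥ D : W_t ≤ C₁}. Then E(η^{τ'} | G_0) ≤ η^{D} · (1 + (a_0 + κ C₁)/(1−κ)) a.s. -/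
open MeasureTheory
open scoped Classical

/-- The drift inequality `E(Y | m) ≤ κ X + a`, integrated over a set of `m`. -/
theorem setIntegral_le_of_condExp_le_affine {Ω : Type*} {m m0 : MeasurableSpace Ω}
    {P : Measure Ω} [IsFiniteMeasure P] (hm : m ≤ m0) {X Y : Ω → ℝ} (hX : Integrable X P)
    (hY : Integrable Y P) {κ a : ℝ} (h : ∀ᵐ ω ∂P, (P[Y | m]) ω ≤ κ * X ω + a)
    {B : Set Ω} (hB : MeasurableSet[m] B) :
    ∫ ω in B, Y ω ∂P ≤ κ * ∫ ω in B, X ω ∂P + a * P.real B := by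
  have hX' : Integrable (fun ω => κ * X ω) (P.restrict B) := (hX.const_mul κ).integrableOn
  rw [← setIntegral_condExp hm hY hB]
  calc ∫ ω in B, (P[Y | m]) ω ∂P ≤ ∫ ω in B, (κ * X ω + a) ∂P :=
        integral_mono_ae integrable_condExp.integrableOn (hX'.add (integrable_const a))
          (ae_restrict_of_ae h)
    _ = κ * ∫ ω in B, X ω ∂P + a * P.real B := by
        rw [integral_add hX' (integrable_const a), integral_const_mul, setIntegral_const,
          smul_eq_mul, mul_comm a]

/-- The exponential of a return time is dominated by a sum over the times before the return. -/
theorem ofReal_pow_find_le_tsum {η : ℝ} (hη : 1 ≤ η) (w : ℕ → ℝ) (c : ℝ) (D : ℕ) :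
    (if h : ∃ t, D ≤ t ∧ w t ≤ c then ENNReal.ofReal (η ^ (Nat.find h)) else ⊤) ≤
      ENNReal.ofReal (η ^ D) + ∑' n : ℕ,
        (if ∀ k < n + 1, c < w (D + k) then ENNReal.ofReal (η ^ (D + n + 1)) else 0) := by
  split_ifs with h
  · obtain ⟨hDt, -⟩ := Nat.find_spec h
    have hmin : ∀ m < Nat.find h, ¬(D ≤ m ∧ w m ≤ c) := fun m hm => Nat.find_min h hm
    generalize Nat.find h = τ at hDt hmin
    obtain ⟨n, rfl⟩ := Nat.exists_eq_add_of_le hDt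
    rcases n with _ | n
    · exact le_self_add
    · refine le_trans ?_ le_add_self
      refine le_trans ?_ (ENNReal.le_tsum n)
      rw [if_pos]
      · rfl
      · intro k hk
        have := hmin (D + k) (by omega)
        by_contra! hc
        exact this ⟨by omega, hc⟩
  · push Not at h
    have htop : ∑' _ : ℕ, (1 : ENNReal) = ⊤ := ENNReal.tsum_const_eq_top_of_ne_zero one_ne_zero
    rw [← htop]
    refine le_trans (ENNReal.tsum_le_tsum fun n => ?_) le_add_self
    rw [if_pos fun k _ => h _ (by omega), ← ENNReal.ofReal_one]
    exact ENNReal.ofReal_le_ofReal (one_le_pow₀ hη)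

/-- for a nonnegative adapted integrable process `(W_t)` with drift
`E(W_t | G_{t−1}) ≤ κ W_{t−1} + a_0`, `η = 2/(1+κ)`, `C₁ = (2a₀+2)/(1−κ)`, `W_0 ≤ C₁` a.s.,
and the retarded return time `τ' = inf{t ≥ D : W_t ≤ C₁}`, one has
`E(η^{τ'} | G_0) ≤ η^D (1 + (a₀ + κC₁)/(1−κ))` a.s. (with `η^{τ'} = ∞` on `{τ' = ∞}`);
formulated via the defining integral inequality of the conditional expectation over sets
`A ∈ G_0`. -/
theorem stmt_6 {Ω : Type*} {m0 : MeasurableSpace Ω} (P : Measure Ω) [IsProbabilityMeasure P]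
    (G : ℕ → MeasurableSpace Ω) (hGle : ∀ t, G t ≤ m0) (hGmono : Monotone G)
    (W : ℕ → Ω → ℝ) (hadapt : ∀ t, Measurable[G t] (W t))
    (hpos : ∀ t ω, 0 ≤ W t ω) (hint : ∀ t, Integrable (W t) P)
    (κ a0 : ℝ) (hκ : κ ∈ Set.Ioo (0 : ℝ) 1) (ha0 : 0 ≤ a0)
    (hdrift : ∀ t : ℕ, 1 ≤ t → ∀ᵐ ω ∂P, (P[W t | G (t - 1)]) ω ≤ κ * W (t - 1) ω + a0)
    (η C₁ : ℝ) (hη : η = 2 / (1 + κ)) (hC₁ : C₁ = (2 * a0 + 2) / (1 - κ))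
    (hW0 : ∀ᵐ ω ∂P, W 0 ω ≤ C₁) (D : ℕ) (hD : 1 ≤ D) :
    ∀ A : Set Ω, MeasurableSet[G 0] A →
      ∫⁻ ω in A,
          (if h : ∃ t, D ≤ t ∧ W t ω ≤ C₁ then ENNReal.ofReal (η ^ (Nat.find h)) else ⊤) ∂P
        ≤ ENNReal.ofReal (η ^ D * (1 + (a0 + κ * C₁) / (1 - κ))) * P A := by
  intro A hA
  obtain ⟨hκ0, hκ1⟩ := hκ
  have h1κ : 0 < 1 - κ := by linarith
  have hη1 : 1 ≤ η := by rw [hη, le_div_iff₀ (by linarith)]; linarith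
  have hη0 : 0 < η := by linarith
  have hηκ : η * (1 + κ) = 2 := by rw [hη]; field_simp
  have hC : C₁ * (1 - κ) = 2 * a0 + 2 := by rw [hC₁]; field_simp
  have hdrift' : ∀ (t : ℕ) {B : Set Ω}, MeasurableSet[G t] B →
      ∫ ω in B, W (t + 1) ω ∂P ≤ κ * ∫ ω in B, W t ω ∂P + a0 * P.real B := fun t B hB =>
    setIntegral_le_of_condExp_le_affine (hGle t) (hint t) (hint (t + 1))
      (by simpa using hdrift (t + 1) (by omega)) hB
  have hPA : 0 ≤ P.real A := measureReal_nonneg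
  have hmean : ∀ n, ∫ ω in A, W (n + 1) ω ∂P ≤ (κ * C₁ + a0 / (1 - κ)) * P.real A := by
    have ha : a0 / (1 - κ) * (1 - κ) = a0 := by field_simp
    have ha' : 0 ≤ a0 / (1 - κ) := by positivity
    have hC0 : 0 ≤ C₁ := by rw [hC₁]; positivity
    intro n
    induction n with
    | zero =>
      have h0 : ∫ ω in A, W 0 ω ∂P ≤ C₁ * P.real A := by
        calc ∫ ω in A, W 0 ω ∂P ≤ ∫ _ in A, C₁ ∂P :=
              integral_mono_ae (hint 0).integrableOn (integrable_const _) (ae_restrict_of_ae hW0)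
          _ = C₁ * P.real A := by rw [setIntegral_const, smul_eq_mul, mul_comm]
      calc _ ≤ _ := hdrift' 0 hA
        _ ≤ κ * (C₁ * P.real A) + a0 * P.real A := by gcongr
        _ = (κ * C₁ + a0) * P.real A := by ring
        _ ≤ _ := by
          gcongr
          nlinarith
    | succ n ih =>
      calc _ ≤ _ := hdrift' (n + 1) (hGmono (Nat.zero_le _) _ hA)
        _ ≤ κ * ((κ * C₁ + a0 / (1 - κ)) * P.real A) + a0 * P.real A := by gcongr
        _ = (κ * (κ * C₁ + a0 / (1 - κ)) + a0) * P.real A := by ring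
        _ ≤ _ := by
          refine mul_le_mul_of_nonneg_right ?_ hPA
          nlinarith [mul_nonneg (mul_nonneg hκ0.le hC0) h1κ.le]
  let S : ℕ → Set Ω := fun N => {ω | ∀ k < N, C₁ < W (D + k) ω}
  have hS : ∀ N, MeasurableSet[G (D + N)] (S (N + 1)) := by
    intro N
    have : S (N + 1) = ⋂ k, ⋂ (_ : k < N + 1), {ω | C₁ < W (D + k) ω} := by
      ext ω; simp [S]
    rw [this]
    refine MeasurableSet.iInter fun k => MeasurableSet.iInter fun hk => ?_
    exact hGmono (by omega : D + k ≤ D + N) _ (hadapt (D + k) measurableSet_Ioi)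
  have hSm : ∀ N, MeasurableSet (S (N + 1)) := fun N => hGle _ _ (hS N)
  have hsum : ∀ N, ∑ n ∈ Finset.range N, η ^ (D + n + 1) * P.real (S (n + 1) ∩ A) +
      η ^ (D + N) * ∫ ω in S N ∩ A, W (D + N) ω ∂P ≤ η ^ D * ∫ ω in A, W D ω ∂P := by
    intro N
    induction N with
    | zero => simp [S]
    | succ N ih =>
      refine le_trans ?_ ih
      rw [Finset.sum_range_succ, add_assoc]
      gcongr
      have hB : MeasurableSet[G (D + N)] (S (N + 1) ∩ A) :=
        (hS N).inter (hGmono (Nat.zero_le _) _ hA)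
      have hstep := hdrift' (D + N) hB
      have hsub : ∫ ω in S (N + 1) ∩ A, W (D + N) ω ∂P ≤ ∫ ω in S N ∩ A, W (D + N) ω ∂P :=
        setIntegral_mono_set (hint _).integrableOn (ae_of_all _ (hpos _))
          (LE.le.eventuallyLE fun ω hω => ⟨fun k hk => hω.1 k (by omega), hω.2⟩)
      have hlow : C₁ * P.real (S (N + 1) ∩ A) ≤ ∫ ω in S (N + 1) ∩ A, W (D + N) ω ∂P := by
        calc C₁ * P.real (S (N + 1) ∩ A) = ∫ _ in S (N + 1) ∩ A, C₁ ∂P := by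
              rw [setIntegral_const, smul_eq_mul, mul_comm]
          _ ≤ _ := setIntegral_mono_on (integrable_const _).integrableOn (hint _).integrableOn
              (hGle _ _ hB) fun ω hω => (hω.1 N (by omega)).le
      have hcontract : η * (P.real (S (N + 1) ∩ A) + ∫ ω in S (N + 1) ∩ A, W (D + N + 1) ω ∂P) ≤
          ∫ ω in S (N + 1) ∩ A, W (D + N) ω ∂P := by
        generalize P.real (S (N + 1) ∩ A) = p at *
        generalize ∫ ω in S (N + 1) ∩ A, W (D + N) ω ∂P = x at *
        generalize ∫ ω in S (N + 1) ∩ A, W (D + N + 1) ω ∂P = y at *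
        have hlin : 2 * (p + y) ≤ (1 + κ) * x := by
          have : (2 * a0 + 2) * p ≤ (1 - κ) * x := by
            rw [← hC]
            calc C₁ * (1 - κ) * p = (1 - κ) * (C₁ * p) := by ring
              _ ≤ _ := by gcongr
          linarith
        have := mul_le_mul_of_nonneg_left hlin hη0.le
        rw [← mul_assoc η (1 + κ), hηκ] at this
        linarith
      calc _ = η ^ (D + N) * (η * (P.real (S (N + 1) ∩ A) +
              ∫ ω in S (N + 1) ∩ A, W (D + N + 1) ω ∂P)) := by
            rw [← add_assoc D N 1]; ring
        _ ≤ _ := by gcongr; exact hcontract.trans hsub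
  have htsum : ∑' n : ℕ, ENNReal.ofReal (η ^ (D + n + 1)) * P (S (n + 1) ∩ A) ≤
      ENNReal.ofReal (η ^ D * ∫ ω in A, W D ω ∂P) := by
    rw [ENNReal.tsum_eq_iSup_nat]
    refine iSup_le fun N => ?_
    have hterm : ∀ n, ENNReal.ofReal (η ^ (D + n + 1)) * P (S (n + 1) ∩ A) =
        ENNReal.ofReal (η ^ (D + n + 1) * P.real (S (n + 1) ∩ A)) := fun n => by
      rw [ENNReal.ofReal_mul (by positivity), ofReal_measureReal]
    simp only [hterm]
    rw [← ENNReal.ofReal_sum_of_nonneg fun n _ => by positivity]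
    refine ENNReal.ofReal_le_ofReal (le_trans (le_add_of_nonneg_right ?_) (hsum N))
    exact mul_nonneg (by positivity) (integral_nonneg (hpos _))
  calc _ ≤ ∫⁻ ω in A, (ENNReal.ofReal (η ^ D) + ∑' n : ℕ,
          (S (n + 1)).indicator (fun _ => ENNReal.ofReal (η ^ (D + n + 1))) ω) ∂P := by
        refine lintegral_mono fun ω => ?_
        refine (ofReal_pow_find_le_tsum hη1 (fun t => W t ω) C₁ D).trans (le_of_eq ?_)
        simp only [Set.indicator_apply, S, Set.mem_ofPred_eq]
    _ = ENNReal.ofReal (η ^ D) * P A +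
          ∑' n : ℕ, ENNReal.ofReal (η ^ (D + n + 1)) * P (S (n + 1) ∩ A) := by
        rw [lintegral_add_left measurable_const, setLIntegral_const,
          lintegral_tsum fun n => (measurable_const.indicator (hSm n)).aemeasurable]
        congr 2 with n
        rw [lintegral_indicator_const (hSm n), Measure.restrict_apply (hSm n)]
    _ ≤ ENNReal.ofReal (η ^ D * P.real A) + ENNReal.ofReal (η ^ D * ∫ ω in A, W D ω ∂P) := by
        rw [ENNReal.ofReal_mul (by positivity), ofReal_measureReal]
        gcongr
    _ = ENNReal.ofReal (η ^ D * (P.real A + ∫ ω in A, W D ω ∂P)) := by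
        rw [← ENNReal.ofReal_add (by positivity)
          (mul_nonneg (by positivity) (integral_nonneg (hpos _))), mul_add]
    _ ≤ ENNReal.ofReal (η ^ D * (1 + (a0 + κ * C₁) / (1 - κ)) * P.real A) := by
        refine ENNReal.ofReal_le_ofReal ?_
        obtain ⟨d, rfl⟩ := Nat.exists_eq_add_of_le' hD
        have hm := hmean d
        have hle : κ * C₁ ≤ κ * C₁ / (1 - κ) := by
          have hC0 : 0 ≤ C₁ := by rw [hC₁]; positivity
          exact le_div_self (by positivity) h1κ (by linarith)
        have := mul_le_mul_of_nonneg_right hle hPA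
        rw [mul_assoc, add_div]
        gcongr
        linarith
    _ = _ := by
        rw [ENNReal.ofReal_mul' hPA, ofReal_measureReal]
end

section
/- Let 0 < λ ≤ λ' and let p_λ denote the density of the centered normal distribution N(0,λ), i.e. p_λ(x) = (2πλ)^{−1/2} exp(−x²/(2λ)). Then ∫_ℝ min(p_λ(x), p_{λ'}(x)) dx ≥ √(λ/λ'). -/
open MeasureTheory Real

/-- The centered Gaussian density is integrable, with integral `1`. -/
lemma centered_gaussian_integrable_and_integral_eq_one {v : ℝ} (hv : 0 < v) :
    Integrable (fun x : ℝ => (√(2 * π * v))⁻¹ * exp (-(x ^ 2) / (2 * v))) ∧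
      ∫ x : ℝ, (√(2 * π * v))⁻¹ * exp (-(x ^ 2) / (2 * v)) = 1 := by
  have hfun : (fun x : ℝ => (√(2 * π * v))⁻¹ * exp (-(x ^ 2) / (2 * v))) =
      ProbabilityTheory.gaussianPDFReal 0 ⟨v, hv.le⟩ := by
    ext x
    simp only [ProbabilityTheory.gaussianPDFReal, sub_zero]
    rfl
  have hne : (⟨v, hv.le⟩ : NNReal) ≠ 0 := fun h => hv.ne' (congrArg NNReal.toReal h)
  rw [hfun]
  exact ⟨ProbabilityTheory.integrable_gaussianPDFReal _ _,
    ProbabilityTheory.integral_gaussianPDFReal_eq_one 0 hne⟩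

/-- For `0 < λ ≤ λ'`, the integral of the pointwise minimum of the centered
Gaussian densities `p_λ` and `p_{λ'}` is at least `√(λ/λ')`. -/
theorem stmt_8 (lam lam' : ℝ) (h0 : 0 < lam) (hle : lam ≤ lam') :
    Real.sqrt (lam / lam') ≤
      ∫ x : ℝ,
        min ((Real.sqrt (2 * Real.pi * lam))⁻¹ * Real.exp (-(x ^ 2) / (2 * lam)))
            ((Real.sqrt (2 * Real.pi * lam'))⁻¹ * Real.exp (-(x ^ 2) / (2 * lam'))) := by
  have h0' : 0 < lam' := h0.trans_le hle
  obtain ⟨hint, hone⟩ := centered_gaussian_integrable_and_integral_eq_one h0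
  have hint' := (centered_gaussian_integrable_and_integral_eq_one h0').1
  have hconst : √(lam / lam') * (√(2 * π * lam))⁻¹ = (√(2 * π * lam'))⁻¹ := by
    rw [← sqrt_inv, ← sqrt_inv, ← sqrt_mul (by positivity)]
    congr 1
    field_simp
  calc √(lam / lam')
      = ∫ x : ℝ, √(lam / lam') * ((√(2 * π * lam))⁻¹ * exp (-(x ^ 2) / (2 * lam))) := by
        rw [integral_const_mul, hone, mul_one]
    _ ≤ _ := by
        refine integral_mono (hint.const_mul _) (hint.inf hint') fun x => le_min ?_ ?_
        · refine mul_le_of_le_one_left (by positivity) ?_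
          exact sqrt_le_one.mpr ((div_le_one h0').mpr hle)
        · simp only [← mul_assoc, hconst, neg_div]
          gcongr
end

section
/- Let 0 < ω and let λ, λ' ≥ ω. Then the total variation distance between the centered normal distributions satisfies TV(N(0,λ), N(0,λ')) ≤ 1 − exp(−|λ − λ'|/ω). -/
open MeasureTheory ProbabilityTheory Real

theorem tvDist_comm {S : Type*} [MeasurableSpace S] (μ ν : Measure S) :
    tvDist μ ν = tvDist ν μ := by
  simp only [tvDist, abs_sub_comm]

/-- If `ν` dominates `c • μ` setwise, then the total variation distance is at most `1 - c`. -/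
theorem tvDist_le_one_sub {S : Type*} [MeasurableSpace S] {μ ν : Measure S}
    [IsProbabilityMeasure μ] [IsProbabilityMeasure ν] {c : ℝ} (hc : c ≤ 1)
    (h : ∀ A, MeasurableSet A → c * μ.real A ≤ ν.real A) : tvDist μ ν ≤ 1 - c := by
  have : Nonempty {A : Set S // MeasurableSet A} := ⟨⟨∅, .empty⟩⟩
  refine ciSup_le fun ⟨A, hA⟩ ↦ ?_
  change |μ.real A - ν.real A| ≤ 1 - c
  have h₁ := h A hA
  have h₂ := h Aᶜ hA.compl
  rw [probReal_compl_eq_one_sub hA, probReal_compl_eq_one_sub hA] at h₂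
  have hμ₀ : 0 ≤ μ.real A := measureReal_nonneg
  have hμ₁ : μ.real A ≤ 1 := measureReal_le_one
  rw [abs_le]
  constructor <;> nlinarith

theorem exp_neg_div_mul_gaussianPDFReal_le {ω lam lam' : ℝ} (hω : 0 < ω) (h1 : ω ≤ lam)
    (hle : lam ≤ lam') (x : ℝ) :
    exp (-(lam' - lam) / ω) * gaussianPDFReal 0 lam.toNNReal x
      ≤ gaussianPDFReal 0 lam'.toNNReal x := by
  have hlam : 0 < lam := hω.trans_le h1
  have hlam' : 0 < lam' := hlam.trans_le hle
  have hratio : exp (-(lam' - lam) / ω) ≤ lam / lam' := by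
    have hd : (lam' - lam) / lam ≤ (lam' - lam) / ω :=
      div_le_div_of_nonneg_left (sub_nonneg.2 hle) hω h1
    have hexp : lam' / lam ≤ exp ((lam' - lam) / ω) := by
      calc lam' / lam = (lam' - lam) / lam + 1 := by field_simp; ring
        _ ≤ (lam' - lam) / ω + 1 := by gcongr
        _ ≤ exp ((lam' - lam) / ω) := add_one_le_exp _
    rw [neg_div, exp_neg, ← inv_div lam' lam]
    exact inv_anti₀ (by positivity) hexp
  have hsqrt : exp (-(lam' - lam) / ω) * (√(2 * π * lam))⁻¹ ≤ (√(2 * π * lam'))⁻¹ := by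
    have hratio_sqrt : lam / lam' ≤ √(lam / lam') := by
      apply le_sqrt_of_sq_le
      have : lam / lam' ≤ 1 := (div_le_one hlam').2 hle
      have : 0 ≤ lam / lam' := by positivity
      nlinarith
    calc exp (-(lam' - lam) / ω) * (√(2 * π * lam))⁻¹
        ≤ √(lam / lam') * (√(2 * π * lam))⁻¹ := by
          gcongr
          exact hratio.trans hratio_sqrt
      _ = (√(2 * π * lam'))⁻¹ := by
          rw [sqrt_div hlam.le, sqrt_mul (by positivity) lam, sqrt_mul (by positivity) lam']
          have := (sqrt_pos.2 hlam).ne'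
          field_simp
  simp only [gaussianPDFReal, coe_toNNReal _ hlam.le, coe_toNNReal _ hlam'.le, sub_zero,
    ← mul_assoc]
  gcongr ?_ * exp ?_
  rw [neg_div, neg_div, neg_le_neg_iff]
  gcongr

theorem tvDist_gaussianReal_le_of_le {ω lam lam' : ℝ} (hω : 0 < ω) (h1 : ω ≤ lam)
    (hle : lam ≤ lam') :
    tvDist (gaussianReal 0 lam.toNNReal) (gaussianReal 0 lam'.toNNReal)
      ≤ 1 - exp (-(lam' - lam) / ω) := by
  have hv : lam.toNNReal ≠ 0 := (toNNReal_pos.2 (hω.trans_le h1)).ne'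
  have hv' : lam'.toNNReal ≠ 0 := (toNNReal_pos.2 (hω.trans_le (h1.trans hle))).ne'
  refine tvDist_le_one_sub ?_ fun A _ ↦ ?_
  · rw [exp_le_one_iff, neg_div, neg_nonpos]
    exact div_nonneg (sub_nonneg.2 hle) hω.le
  · have hint (v) : 0 ≤ ∫ x in A, gaussianPDFReal 0 v x :=
      integral_nonneg fun x ↦ gaussianPDFReal_nonneg 0 v x
    rw [measureReal_def, measureReal_def, gaussianReal_apply_eq_integral _ hv,
      gaussianReal_apply_eq_integral _ hv', ENNReal.toReal_ofReal (hint _),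
      ENNReal.toReal_ofReal (hint _), ← integral_const_mul]
    exact integral_mono ((integrable_gaussianPDFReal _ _).integrableOn.const_mul _)
      (integrable_gaussianPDFReal _ _).integrableOn
      fun x ↦ exp_neg_div_mul_gaussianPDFReal_le hω h1 hle x

/-- if `λ, λ' ≥ ω > 0` then
`TV(N(0,λ), N(0,λ')) ≤ 1 − exp(−|λ−λ'|/ω)`. -/
theorem stmt_9 (ω lam lam' : ℝ) (hω : 0 < ω) (h1 : ω ≤ lam) (h2 : ω ≤ lam') :
    tvDist (gaussianReal 0 lam.toNNReal) (gaussianReal 0 lam'.toNNReal)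
      ≤ 1 - Real.exp (-|lam - lam'| / ω) := by
  rcases le_total lam lam' with hle | hle
  · rw [abs_sub_comm, abs_of_nonneg (sub_nonneg.2 hle)]
    exact tvDist_gaussianReal_le_of_le hω h1 hle
  · rw [tvDist_comm, abs_of_nonneg (sub_nonneg.2 hle)]
    exact tvDist_gaussianReal_le_of_le hω h2 hle
end

section
/- For all λ, λ' ≥ 0, the total variation distance between Poisson distributions satisfies TV(Poisson(λ), Poisson(λ')) ≤ 1 − exp(−|λ − λ'|). -/
open MeasureTheory ProbabilityTheory Real

open scoped NNReal ENNReal in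
/-- For `r ≤ s`, the Poisson measure of parameter `s` dominates `exp (-(s - r))` times the Poisson
measure of parameter `r`. -/
theorem exp_smul_poissonMeasure_le {r s : ℝ≥0} (hrs : r ≤ s) :
    ENNReal.ofReal (Real.exp (-((s : ℝ) - r))) • poissonMeasure r ≤ poissonMeasure s := by
  refine Measure.le_iff.2 fun A _ => ?_
  rw [← Measure.tsum_indicator_apply_singleton _ A (MeasurableSet.of_discrete),
    ← Measure.tsum_indicator_apply_singleton _ A (MeasurableSet.of_discrete)]
  refine ENNReal.tsum_le_tsum fun n => Set.indicator_le_indicator ?_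
  rw [Measure.smul_apply, smul_eq_mul, poissonMeasure_singleton, poissonMeasure_singleton,
    ← ENNReal.ofReal_mul (Real.exp_nonneg _)]
  refine ENNReal.ofReal_le_ofReal ?_
  rw [← mul_div_assoc, ← mul_assoc, ← Real.exp_add,
    show -((s : ℝ) - r) + -(r : ℝ) = -(s : ℝ) by ring]
  gcongr

/-- If a probability measure `ν` dominates `c • μ` for a probability measure `μ`, then the values of
`μ` and `ν` on any measurable set differ by at most `1 - c`. -/
theorem abs_measureReal_sub_le_of_smul_le {S : Type*} [MeasurableSpace S] {μ ν : Measure S}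
    [IsProbabilityMeasure μ] [IsProbabilityMeasure ν] {c : ℝ} (hc : 0 ≤ c) (hc1 : c ≤ 1)
    (h : ENNReal.ofReal c • μ ≤ ν) {A : Set S} (hA : MeasurableSet A) :
    |μ.real A - ν.real A| ≤ 1 - c := by
  have key (B : Set S) : c * μ.real B ≤ ν.real B := by
    have hB := ENNReal.toReal_mono (measure_ne_top ν B) (h B)
    rwa [Measure.smul_apply, smul_eq_mul, ENNReal.toReal_mul, ENNReal.toReal_ofReal hc] at hB
  have hAc := key Aᶜ
  rw [probReal_compl_eq_one_sub hA, probReal_compl_eq_one_sub hA] at hAc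
  have h0 : 0 ≤ μ.real A := measureReal_nonneg
  have h1 : μ.real A ≤ 1 := measureReal_le_one
  rw [abs_le]
  constructor <;> nlinarith [key A]

/-- for all `λ, λ' ≥ 0`,
`TV(Poisson(λ), Poisson(λ')) ≤ 1 − exp(−|λ−λ'|)`. -/
theorem stmt_10 (lam lam' : ℝ) (h : 0 ≤ lam) (h' : 0 ≤ lam') :
    tvDist (poissonMeasure lam.toNNReal) (poissonMeasure lam'.toNNReal)
      ≤ 1 - Real.exp (-|lam - lam'|) := by
  have hne : Nonempty {A : Set ℕ // MeasurableSet A} := ⟨⟨∅, MeasurableSet.empty⟩⟩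
  refine ciSup_le fun A => ?_
  change |(poissonMeasure _).real A.1 - (poissonMeasure _).real A.1| ≤ _
  lift lam to NNReal using h
  lift lam' to NNReal using h'
  rw [Real.toNNReal_coe, Real.toNNReal_coe]
  wlog hle : lam ≤ lam' generalizing lam lam'
  · rw [abs_sub_comm, abs_sub_comm (lam : ℝ)]
    exact this lam' lam (le_of_not_ge hle)
  have hle' : (lam : ℝ) ≤ lam' := hle
  rw [abs_sub_comm (lam : ℝ), abs_of_nonneg (sub_nonneg.2 hle')]
  exact abs_measureReal_sub_le_of_smul_le (Real.exp_nonneg _)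
    (Real.exp_le_one_iff.2 (by linarith)) (exp_smul_poissonMeasure_le hle) A.2
end

section
/- Let Z be a nonnegative integrable random variable with δ = E[Z], and for λ ≥ 0 let Q_MP(λ) denote the mixed Poisson distribution on ℕ₀ with Q_MP(λ)({k}) = E[ e^{−λZ} (λZ)^k / k! ]. Then for all λ, λ' ≥ 0, TV(Q_MP(λ), Q_MP(λ')) ≤ E[ 1 − e^{−Z|λ−λ'|} ] ≤ 1 − e^{−δ|λ−λ'|}. -/
open MeasureTheory Real

/-- The mixed Poisson distribution on `ℕ` with mixing variable `Z` and intensity parameter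
`λ`: `Q_MP(λ)({k}) = E[e^{−λZ} (λZ)^k / k!]`. -/
noncomputable def mixedPoisson {Ω : Type*} [MeasurableSpace Ω] (P : Measure Ω)
    (Z : Ω → ℝ) (lam : ℝ) : Measure ℕ :=
  Measure.sum fun k =>
    (ENNReal.ofReal (∫ ω, Real.exp (-(lam * Z ω)) * (lam * Z ω) ^ k / (Nat.factorial k) ∂P)) •
      Measure.dirac k

open ProbabilityTheory in
/-- The mixed Poisson distribution is the mixture of Poisson laws with rate `lam * Z`. -/
lemma mixedPoisson_apply {Ω : Type*} [MeasurableSpace Ω] (P : Measure Ω) [IsFiniteMeasure P]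
    {Z : Ω → ℝ} (hZmeas : Measurable Z) (hZpos : ∀ ω, 0 ≤ Z ω) {lam : ℝ} (h : 0 ≤ lam)
    (A : Set ℕ) :
    mixedPoisson P Z lam A = ∫⁻ ω, poissonMeasure (lam * Z ω).toNNReal A ∂P := by
  have hA : MeasurableSet A := MeasurableSet.of_discrete
  have hcoe (ω : Ω) : ((lam * Z ω).toNNReal : ℝ) = lam * Z ω :=
    Real.coe_toNNReal _ (mul_nonneg h (hZpos ω))
  have hnonneg (k : ℕ) (ω : Ω) :
      0 ≤ Real.exp (-(lam * Z ω)) * (lam * Z ω) ^ k / (Nat.factorial k) := by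
    have := mul_nonneg h (hZpos ω)
    positivity
  have hmeas (k : ℕ) : Measurable fun ω ↦
      Real.exp (-(lam * Z ω)) * (lam * Z ω) ^ k / (Nat.factorial k) := by fun_prop
  have hint (k : ℕ) : Integrable (fun ω ↦
      Real.exp (-(lam * Z ω)) * (lam * Z ω) ^ k / (Nat.factorial k)) P := by
    refine Integrable.of_bound (hmeas k).aestronglyMeasurable 1 (ae_of_all _ fun ω ↦ ?_)
    rw [Real.norm_of_nonneg (hnonneg k ω), ← hcoe ω, ← poissonMeasure_real_singleton]
    exact measureReal_le_one
  simp only [mixedPoisson, poissonMeasure, Measure.sum_apply _ hA, Measure.smul_apply,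
    smul_eq_mul, hcoe]
  rw [lintegral_tsum fun k ↦ ((hmeas k).ennreal_ofReal.mul_const _).aemeasurable]
  congr 1 with k
  rw [lintegral_mul_const _ (hmeas k).ennreal_ofReal,
    ofReal_integral_eq_lintegral_ofReal (hint k) (ae_of_all _ (hnonneg k))]

open ProbabilityTheory in
lemma measurable_poissonMeasure_apply (A : Set ℕ) :
    Measurable fun r : NNReal ↦ poissonMeasure r A := by
  simp only [poissonMeasure, Measure.sum_apply _ (MeasurableSet.of_discrete (s := A)),
    Measure.smul_apply, smul_eq_mul]
  fun_prop

open ProbabilityTheory in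
lemma exp_mul_poissonMeasure_le {r s : NNReal} (hrs : r ≤ s) (A : Set ℕ) :
    Real.exp (-(s - r : ℝ)) * (poissonMeasure r).real A ≤ (poissonMeasure s).real A := by
  have hA : MeasurableSet A := MeasurableSet.of_discrete
  have key : ENNReal.ofReal (Real.exp (-(s - r : ℝ))) * poissonMeasure r A
      ≤ poissonMeasure s A := by
    simp only [poissonMeasure, Measure.sum_apply _ hA, Measure.smul_apply, smul_eq_mul]
    rw [← ENNReal.tsum_mul_left]
    refine ENNReal.tsum_le_tsum fun k ↦ ?_
    rw [← mul_assoc, ← ENNReal.ofReal_mul (Real.exp_pos _).le, ← mul_div_assoc, ← mul_assoc,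
      ← Real.exp_add, show -(s - r : ℝ) + -r = -s by ring]
    have : (r : ℝ) ≤ s := hrs
    gcongr
  have := ENNReal.toReal_mono (measure_ne_top _ _) key
  rwa [ENNReal.toReal_mul, ENNReal.toReal_ofReal (Real.exp_pos _).le] at this

open ProbabilityTheory in
lemma poissonMeasure_real_sub_le (r s : NNReal) (A : Set ℕ) :
    (poissonMeasure r).real A - (poissonMeasure s).real A ≤ 1 - Real.exp (-|(r - s : ℝ)|) := by
  have main {r s : NNReal} (hrs : r ≤ s) (A : Set ℕ) :
      (poissonMeasure r).real A - (poissonMeasure s).real A ≤ 1 - Real.exp (-(s - r : ℝ)) := by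
    have h1 := exp_mul_poissonMeasure_le hrs A
    have h2 : (poissonMeasure r).real A ≤ 1 := measureReal_le_one
    have h3 : Real.exp (-(s - r : ℝ)) ≤ 1 :=
      Real.exp_le_one_iff.2 (neg_nonpos.2 (sub_nonneg.2 hrs))
    nlinarith
  rcases le_total r s with hrs | hrs
  · rw [abs_sub_comm, abs_of_nonneg (sub_nonneg.2 (NNReal.coe_le_coe.2 hrs))]
    exact main hrs A
  · rw [abs_of_nonneg (sub_nonneg.2 (NNReal.coe_le_coe.2 hrs))]
    have := main hrs Aᶜ
    rw [probReal_compl_eq_one_sub MeasurableSet.of_discrete,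
      probReal_compl_eq_one_sub MeasurableSet.of_discrete] at this
    linarith

open ProbabilityTheory in
lemma mixedPoisson_toReal_sub_le {Ω : Type*} [MeasurableSpace Ω] (P : Measure Ω)
    [IsFiniteMeasure P] {Z : Ω → ℝ} (hZmeas : Measurable Z) (hZpos : ∀ ω, 0 ≤ Z ω)
    {lam lam' : ℝ} (h : 0 ≤ lam) (h' : 0 ≤ lam') (A : Set ℕ) :
    (mixedPoisson P Z lam A).toReal - (mixedPoisson P Z lam' A).toReal
      ≤ ∫ ω, (1 - Real.exp (-(Z ω * |lam - lam'|))) ∂P := by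
  have hmeas (l : ℝ) : Measurable fun ω ↦ poissonMeasure (l * Z ω).toNNReal A :=
    (measurable_poissonMeasure_apply A).comp (by fun_prop)
  have hint (l : ℝ) : Integrable (fun ω ↦ (poissonMeasure (l * Z ω).toNNReal).real A) P := by
    refine Integrable.of_bound (hmeas l).ennreal_toReal.aestronglyMeasurable 1
      (ae_of_all _ fun ω ↦ ?_)
    rw [Real.norm_of_nonneg measureReal_nonneg]
    exact measureReal_le_one
  have heq {l : ℝ} (hl : 0 ≤ l) : (mixedPoisson P Z l A).toReal =
      ∫ ω, (poissonMeasure (l * Z ω).toNNReal).real A ∂P := by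
    rw [mixedPoisson_apply P hZmeas hZpos hl]
    exact (integral_toReal (hmeas l).aemeasurable
      (ae_of_all _ fun ω ↦ measure_lt_top _ _)).symm
  rw [heq h, heq h', ← integral_sub (hint _) (hint _)]
  refine integral_mono ((hint _).sub (hint _)) ?_ fun ω ↦ ?_
  · refine Integrable.of_bound (by fun_prop) 1 (ae_of_all _ fun ω ↦ ?_)
    have h1 : Real.exp (-(Z ω * |lam - lam'|)) ≤ 1 :=
      Real.exp_le_one_iff.2 (neg_nonpos.2 (mul_nonneg (hZpos ω) (abs_nonneg _)))
    rw [Real.norm_of_nonneg (sub_nonneg.2 h1)]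
    linarith [Real.exp_pos (-(Z ω * |lam - lam'|))]
  · have := poissonMeasure_real_sub_le (lam * Z ω).toNNReal (lam' * Z ω).toNNReal A
    rwa [Real.coe_toNNReal _ (mul_nonneg h (hZpos ω)),
      Real.coe_toNNReal _ (mul_nonneg h' (hZpos ω)), ← sub_mul, abs_mul,
      abs_of_nonneg (hZpos ω), mul_comm |_|] at this

/-- for a nonnegative integrable mixing variable `Z` with `δ = E[Z]`,
`TV(Q_MP(λ), Q_MP(λ')) ≤ E[1 − e^{−Z|λ−λ'|}] ≤ 1 − e^{−δ|λ−λ'|}` for all `λ, λ' ≥ 0`. -/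
theorem stmt_11 {Ω : Type*} [MeasurableSpace Ω] (P : Measure Ω) [IsProbabilityMeasure P]
    (Z : Ω → ℝ) (hZmeas : Measurable Z) (hZpos : ∀ ω, 0 ≤ Z ω)
    (hZint : Integrable Z P) (δ : ℝ) (hδ : δ = ∫ ω, Z ω ∂P)
    (lam lam' : ℝ) (h : 0 ≤ lam) (h' : 0 ≤ lam') :
    tvDist (mixedPoisson P Z lam) (mixedPoisson P Z lam')
        ≤ ∫ ω, (1 - Real.exp (-(Z ω * |lam - lam'|))) ∂P ∧
      ∫ ω, (1 - Real.exp (-(Z ω * |lam - lam'|))) ∂P ≤ 1 - Real.exp (-(δ * |lam - lam'|)) := by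
  constructor
  · refine ciSup_le fun A ↦ abs_sub_le_iff.2 ⟨?_, ?_⟩
    · exact mixedPoisson_toReal_sub_le P hZmeas hZpos h h' A.1
    · rw [abs_sub_comm lam lam']
      exact mixedPoisson_toReal_sub_le P hZmeas hZpos h' h A.1
  · have hexp : Integrable (fun ω ↦ Real.exp (-(Z ω * |lam - lam'|))) P := by
      refine Integrable.of_bound (by fun_prop) 1 (ae_of_all _ fun ω ↦ ?_)
      rw [Real.norm_of_nonneg (Real.exp_pos _).le]
      exact Real.exp_le_one_iff.2 (neg_nonpos.2 (mul_nonneg (hZpos ω) (abs_nonneg _)))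
    have jensen := convexOn_exp.map_integral_le Real.continuous_exp.continuousOn isClosed_univ
      (ae_of_all _ fun _ ↦ Set.mem_univ _) (hZint.mul_const |lam - lam'|).neg hexp
    simp only [Pi.neg_apply, integral_neg, integral_mul_const, ← hδ] at jensen
    rw [integral_sub (integrable_const 1) hexp, integral_const, probReal_univ, one_smul]
    exact sub_le_sub_left jensen 1
end

section
/- Let q ≥ 1 and let c_1,…,c_q ≥ 0 with c := c_1 + ⋯ + c_q < 1. Let (e_k)_{k ≥ 2−q} be nonnegative real numbers satisfying e_k ≤ Σ_{i=1}^q c_i e_{k−i} for all k ≥ 2. Then the series Σ_{k=1}^∞ e_k converges and Σ_{k=1}^∞ e_k ≤ (1/(1−c)) · Σ_{i=1}^q e_{2−i}. -/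
/-- Shifting a window of `N` consecutive terms down by `i` adds at most the `i` terms that enter. -/
theorem sum_shift_le (e : ℤ → ℝ) (p N : ℕ) (hnonneg : ∀ k : ℤ, 1 - (p : ℤ) ≤ k → 0 ≤ e k) (i : ℕ)
    (hi : i ≤ p) :
    ∑ k ∈ Finset.range N, e ((k : ℤ) + 1 - i) ≤
      ∑ k ∈ Finset.range N, e ((k : ℤ) + 1) + ∑ j ∈ Finset.range i, e (-(j : ℤ)) := by
  induction i with
  | zero => simp
  | succ i ih =>
    have hshift : ∑ k ∈ Finset.range N, e ((k : ℤ) + 1 - (i + 1 : ℕ)) ≤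
        e (-(i : ℤ)) + ∑ k ∈ Finset.range N, e ((k : ℤ) + 1 - i) := by
      calc ∑ k ∈ Finset.range N, e ((k : ℤ) + 1 - (i + 1 : ℕ))
          = ∑ k ∈ Finset.range N, e ((k : ℤ) - i) :=
            Finset.sum_congr rfl fun k _ => by congr 1; push_cast; ring
        _ ≤ ∑ k ∈ Finset.range (N + 1), e ((k : ℤ) - i) := by
            rw [Finset.sum_range_succ]
            linarith [hnonneg ((N : ℤ) - i) (by omega)]
        _ = e (-(i : ℤ)) + ∑ k ∈ Finset.range N, e ((k : ℤ) + 1 - i) := by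
            rw [Finset.sum_range_succ', add_comm]
            simp
    rw [Finset.sum_range_succ]
    linarith [ih (by omega)]


/-- if `(e_k)_{k ≥ 2−q}` are nonnegative reals with
`e_k ≤ Σ_{i=1}^q c_i e_{k−i}` for all `k ≥ 2`, where `c_i ≥ 0` and `c = Σ c_i < 1`, then
`Σ_{k=1}^∞ e_k` converges and is at most `(1/(1−c)) Σ_{i=1}^q e_{2−i}`. -/
theorem stmt_14 (q : ℕ) (hq : 1 ≤ q) (c : Fin q → ℝ) (hc : ∀ i, 0 ≤ c i)
    (hcsum : ∑ i, c i < 1) (e : ℤ → ℝ)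
    (hnonneg : ∀ k : ℤ, 2 - (q : ℤ) ≤ k → 0 ≤ e k)
    (hrec : ∀ k : ℤ, 2 ≤ k → e k ≤ ∑ i : Fin q, c i * e (k - ((i : ℕ) + 1))) :
    Summable (fun k : ℕ => e ((k : ℤ) + 1)) ∧
      ∑' k : ℕ, e ((k : ℤ) + 1) ≤ (1 / (1 - ∑ i, c i)) * ∑ i : Fin q, e (1 - (i : ℕ)) := by
  obtain ⟨p, rfl⟩ : ∃ p, q = p + 1 := ⟨q - 1, by omega⟩
  have hnn : ∀ k : ℤ, 1 - (p : ℤ) ≤ k → 0 ≤ e k := fun k hk => hnonneg k (by push_cast; omega)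
  have hpos : ∀ k : ℕ, 0 ≤ e ((k : ℤ) + 1) := fun k => hnn _ (by omega)
  set C := ∑ i, c i with hC
  set A := ∑ i : Fin (p + 1), e (1 - (i : ℕ)) with hA
  set B := ∑ j ∈ Finset.range p, e (-(j : ℤ)) with hB
  have hAB : A = B + e 1 := by
    rw [hA, Fin.sum_univ_eq_sum_range (fun i => e (1 - (i : ℤ))), Finset.sum_range_succ']
    simp [hB]
  have hBnn : 0 ≤ B := Finset.sum_nonneg fun j hj => hnn _ (by
    have := Finset.mem_range.1 hj
    omega)
  have hwindow : ∀ (N : ℕ) (i : Fin (p + 1)), ∑ k ∈ Finset.range N, e ((k : ℤ) + 1 - (i : ℕ)) ≤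
      ∑ k ∈ Finset.range N, e ((k : ℤ) + 1) + B := by
    intro N i
    have hi : (i : ℕ) ≤ p := by omega
    refine (sum_shift_le e p N hnn i hi).trans ?_
    gcongr
    refine Finset.sum_le_sum_of_subset_of_nonneg (Finset.range_subset_range.2 hi) fun j hj _ =>
      hnn _ ?_
    have := Finset.mem_range.1 hj
    omega
  have hbound : ∀ N : ℕ, ∑ k ∈ Finset.range N, e ((k : ℤ) + 1) ≤ (1 / (1 - C)) * A := by
    intro N
    set S := ∑ k ∈ Finset.range N, e ((k : ℤ) + 1) with hS
    have hmono : S ≤ ∑ k ∈ Finset.range (N + 1), e ((k : ℤ) + 1) := by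
      rw [Finset.sum_range_succ]
      linarith [hpos N]
    have htail : ∑ k ∈ Finset.range N, e (((k + 1 : ℕ) : ℤ) + 1) ≤ C * (S + B) := by
      calc ∑ k ∈ Finset.range N, e (((k + 1 : ℕ) : ℤ) + 1)
          ≤ ∑ k ∈ Finset.range N, ∑ i : Fin (p + 1), c i * e ((k : ℤ) + 1 - (i : ℕ)) := by
            refine Finset.sum_le_sum fun k _ => (hrec _ (by omega)).trans_eq ?_
            refine Finset.sum_congr rfl fun i _ => ?_
            congr 2
            push_cast
            ring
        _ = ∑ i : Fin (p + 1), c i * ∑ k ∈ Finset.range N, e ((k : ℤ) + 1 - (i : ℕ)) := by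
            rw [Finset.sum_comm]
            simp only [Finset.mul_sum]
        _ ≤ ∑ i : Fin (p + 1), c i * (S + B) :=
            Finset.sum_le_sum fun i _ => mul_le_mul_of_nonneg_left (hwindow N i) (hc i)
        _ = C * (S + B) := by rw [hC, Finset.sum_mul]
    rw [Finset.sum_range_succ'] at hmono
    simp only [Nat.cast_zero, zero_add] at hmono
    rw [one_div, ← div_eq_inv_mul, le_div_iff₀ (by linarith), hAB]
    nlinarith
  exact ⟨summable_of_sum_range_le hpos hbound, Real.tsum_le_of_sum_range_le hpos hbound⟩
end

section
/- Under the semi-contractive condition (A2), if ((Y_t,λ_t))_{t∈ℤ} is a strictly stationary process satisfying the model equation λ_t = f(Y_{t−1},…,Y_{t−p}; λ_{t−1},…,λ_{t−q}) a.s. with E[λ_0] < ∞, then there exists a measurable function g : [0,∞)^ℕ → [0,∞) such that λ_t = g(Y_{t−1}, Y_{t−2}, …) almost surely for every t ∈ ℤ. -/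
open MeasureTheory Filter Topology
open scoped ENNReal

/-- The value at time `t` of the recursion `λ_t = f(Y_{t-1}, …; λ_{t-1}, …)` run through `n`
levels of past values of `λ`, starting from `0`, as a function of the past
`x = (Y_{t-1}, Y_{t-2}, …)`. -/
def pastIterate {p q : ℕ} (f : (Fin p → ℝ) → (Fin q → ℝ) → ℝ) : ℕ → (ℕ → ℝ) → ℝ
  | 0, _ => 0
  | n + 1, x => f (fun i => x i) (fun j => pastIterate f n (fun m => x (m + (j + 1))))

theorem measurable_pastIterate {p q : ℕ} {f : (Fin p → ℝ) → (Fin q → ℝ) → ℝ}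
    (hf : Measurable (Function.uncurry f)) (n : ℕ) : Measurable (pastIterate f n) := by
  induction n with
  | zero => exact measurable_const
  | succ n ih =>
    have h : Measurable fun x : ℕ → ℝ =>
        ((fun i => x i : Fin p → ℝ),
          (fun j => pastIterate f n (fun m => x (m + (j + 1))) : Fin q → ℝ)) := by
      refine Measurable.prodMk ?_ ?_
      · exact measurable_pi_lambda _ fun i => measurable_pi_apply _
      · exact measurable_pi_lambda _ fun j =>
          ih.comp (measurable_pi_lambda _ fun m => measurable_pi_apply _)
    exact hf.comp h

/-- The `L¹` distance between the process and the `n`-th iterate decays geometrically. -/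
theorem lintegral_enorm_sub_pastIterate_le {Ω : Type*} [MeasurableSpace Ω] {P : Measure Ω}
    {p q : ℕ} {f : (Fin p → ℝ) → (Fin q → ℝ) → ℝ} (hf : Measurable (Function.uncurry f))
    {Y lam : ℤ → Ω → ℝ} (hY : ∀ t, Measurable (Y t)) (hlam : ∀ t, Measurable (lam t))
    (hmodel : ∀ t : ℤ, ∀ᵐ ω ∂P,
      lam t ω = f (fun i => Y (t - 1 - (i : ℕ)) ω) (fun j => lam (t - 1 - (j : ℕ)) ω))
    {c : Fin q → ℝ} (hc : ∀ i, 0 ≤ c i)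
    (hcontr : ∀ (y : Fin p → ℝ) (z z' : Fin q → ℝ),
      |f y z - f y z'| ≤ ∑ i, c i * |z i - z' i|)
    {M : ℝ≥0∞} (hM : ∀ t, ∫⁻ ω, ‖lam t ω‖ₑ ∂P ≤ M) (n : ℕ) (t : ℤ) :
    ∫⁻ ω, ‖lam t ω - pastIterate f n (fun m => Y (t - 1 - (m : ℤ)) ω)‖ₑ ∂P
      ≤ ENNReal.ofReal (∑ i, c i) ^ n * M := by
  induction n generalizing t with
  | zero => simpa [pastIterate] using hM t
  | succ n ih =>
    have hmeas (s : ℤ) : Measurable fun ω =>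
        ‖lam s ω - pastIterate f n (fun m => Y (s - 1 - (m : ℤ)) ω)‖ₑ :=
      ((hlam s).sub ((measurable_pastIterate hf n).comp
        (measurable_pi_lambda _ fun m => hY _))).enorm
    calc ∫⁻ ω, ‖lam t ω - pastIterate f (n + 1) (fun m => Y (t - 1 - (m : ℤ)) ω)‖ₑ ∂P
        ≤ ∫⁻ ω, ∑ i : Fin q, ENNReal.ofReal (c i) *
            ‖lam (t - 1 - (i : ℕ)) ω -
              pastIterate f n (fun m => Y (t - 1 - (i : ℕ) - 1 - (m : ℤ)) ω)‖ₑ ∂P := by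
          refine lintegral_mono_ae ?_
          filter_upwards [hmodel t] with ω hω
          have hshift (j : Fin q) :
              (fun m : ℕ => Y (t - 1 - ((m + ((j : ℕ) + 1) : ℕ) : ℤ)) ω)
                = fun m : ℕ => Y (t - 1 - (j : ℕ) - 1 - (m : ℤ)) ω := by
            funext m
            refine congrArg (Y · ω) ?_
            push_cast
            ring
          simp only [pastIterate, hshift]
          rw [hω, Real.enorm_eq_ofReal_abs]
          refine (ENNReal.ofReal_le_ofReal (hcontr _ _ _)).trans_eq ?_
          rw [ENNReal.ofReal_sum_of_nonneg fun i _ => mul_nonneg (hc i) (abs_nonneg _)]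
          simp only [ENNReal.ofReal_mul (hc _), Real.enorm_eq_ofReal_abs]
      _ = ∑ i : Fin q, ENNReal.ofReal (c i) * ∫⁻ ω, ‖lam (t - 1 - (i : ℕ)) ω -
              pastIterate f n (fun m => Y (t - 1 - (i : ℕ) - 1 - (m : ℤ)) ω)‖ₑ ∂P := by
          rw [lintegral_finsetSum _ fun i _ => (hmeas _).const_mul _]
          exact Finset.sum_congr rfl fun i _ => lintegral_const_mul _ (hmeas _)
      _ ≤ ∑ i : Fin q, ENNReal.ofReal (c i) * (ENNReal.ofReal (∑ i, c i) ^ n * M) := by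
          gcongr
          exact ih _
      _ = ENNReal.ofReal (∑ i, c i) ^ (n + 1) * M := by
          rw [← Finset.sum_mul, ← ENNReal.ofReal_sum_of_nonneg fun i _ => hc i, pow_succ']
          ring

/-- A sequence with summable `L¹` distances to a limit converges to it almost everywhere. -/
theorem ae_tendsto_of_tsum_lintegral_enorm_sub_ne_top {Ω : Type*} [MeasurableSpace Ω]
    {P : Measure Ω} {u : ℕ → Ω → ℝ} {v : Ω → ℝ} (hu : ∀ n, Measurable (u n))
    (hv : Measurable v) (h : ∑' n, ∫⁻ ω, ‖v ω - u n ω‖ₑ ∂P ≠ ∞) :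
    ∀ᵐ ω ∂P, Tendsto (fun n => u n ω) atTop (𝓝 (v ω)) := by
  have hmeas (n : ℕ) : Measurable fun ω => ‖v ω - u n ω‖ₑ := (hv.sub (hu n)).enorm
  rw [← lintegral_tsum fun n => (hmeas n).aemeasurable] at h
  filter_upwards [ae_lt_top (Measurable.tsum hmeas) h] with ω hω
  rw [tendsto_iff_edist_tendsto_0]
  simpa only [edist_comm _ (v ω), edist_eq_enorm_sub] using
    ENNReal.tendsto_atTop_zero_of_tsum_ne_top hω.ne

/-- under the semi-contractive condition (A2), for a strictly stationary
process `((Y_t,λ_t))_{t∈ℤ}` satisfying the model equation with `E[λ_0] < ∞`, there exists a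
measurable `g : [0,∞)^ℕ → [0,∞)` with `λ_t = g(Y_{t−1}, Y_{t−2}, …)` a.s. for every `t`
(the orders here are `p+1` and `q+1`). -/
theorem stmt_16
    {Ω : Type*} [MeasurableSpace Ω] (P : Measure Ω) [IsProbabilityMeasure P]
    (p q : ℕ)
    (f : (Fin (p + 1) → ℝ) → (Fin (q + 1) → ℝ) → ℝ)
    (hf : Measurable (Function.uncurry f)) (hfpos : ∀ y z, 0 ≤ f y z)
    -- the strictly stationary process ((Y_t, λ_t))_{t∈ℤ}, with values in [0,∞)
    (Y lam : ℤ → Ω → ℝ)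
    (hYmeas : ∀ t, Measurable (Y t)) (hlammeas : ∀ t, Measurable (lam t))
    (hYpos : ∀ t, ∀ᵐ ω ∂P, 0 ≤ Y t ω) (hlampos : ∀ t, ∀ᵐ ω ∂P, 0 ≤ lam t ω)
    (hstat : ∀ k : ℤ,
      Measure.map (fun ω => fun t : ℤ => (Y (t + k) ω, lam (t + k) ω)) P
        = Measure.map (fun ω => fun t : ℤ => (Y t ω, lam t ω)) P)
    -- the model equation λ_t = f(Y_{t−1},…,Y_{t−p}; λ_{t−1},…,λ_{t−q})
    (hmodel : ∀ t : ℤ, ∀ᵐ ω ∂P,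
      lam t ω = f (fun i => Y (t - 1 - (i : ℕ)) ω) (fun j => lam (t - 1 - (j : ℕ)) ω))
    -- E[λ_0] < ∞
    (hlamint : Integrable (lam 0) P)
    -- (A2) semi-contractive condition
    (c : Fin (q + 1) → ℝ) (hc : ∀ i, 0 ≤ c i) (hcsum : ∑ i, c i < 1)
    (hcontr : ∀ (y : Fin (p + 1) → ℝ) (z z' : Fin (q + 1) → ℝ),
      |f y z - f y z'| ≤ ∑ i, c i * |z i - z' i|) :
    ∃ g : (ℕ → ℝ) → ℝ, Measurable g ∧ (∀ x, 0 ≤ g x) ∧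
      ∀ t : ℤ, ∀ᵐ ω ∂P, lam t ω = g (fun n => Y (t - 1 - (n : ℤ)) ω) := by
  have hM (t : ℤ) : ∫⁻ ω, ‖lam t ω‖ₑ ∂P ≤ ∫⁻ ω, ‖lam 0 ω‖ₑ ∂P := by
    have hφ : Measurable fun x : ℤ → ℝ × ℝ => ‖(x 0).2‖ₑ := (measurable_pi_apply 0).snd.enorm
    have h := congrArg (fun μ => ∫⁻ x, ‖(x 0).2‖ₑ ∂μ) (hstat t)
    rw [lintegral_map hφ (measurable_pi_lambda _ fun s => (hYmeas _).prodMk (hlammeas _)),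
      lintegral_map hφ (measurable_pi_lambda _ fun s => (hYmeas _).prodMk (hlammeas _))] at h
    simpa using h.le
  refine ⟨fun x => max 0 (limsup (fun n => pastIterate f n x) atTop),
    measurable_const.max (Measurable.limsup (measurable_pastIterate hf)),
    fun x => le_max_left _ _, fun t => ?_⟩
  have hlim : ∀ᵐ ω ∂P, Tendsto
      (fun n => pastIterate f n (fun m => Y (t - 1 - (m : ℤ)) ω)) atTop (𝓝 (lam t ω)) := by
    refine ae_tendsto_of_tsum_lintegral_enorm_sub_ne_top
      (fun n => (measurable_pastIterate hf n).comp (measurable_pi_lambda _ fun m => hYmeas _))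
      (hlammeas t) (ne_top_of_le_ne_top ?_ (ENNReal.tsum_le_tsum fun n =>
        lintegral_enorm_sub_pastIterate_le hf hYmeas hlammeas hmodel hc hcontr hM n t))
    rw [ENNReal.tsum_mul_right, ENNReal.tsum_geometric]
    refine ENNReal.mul_ne_top (ENNReal.inv_ne_top.2 (tsub_pos_of_lt ?_).ne') hlamint.2.ne
    exact ENNReal.ofReal_lt_one.2 hcsum
  filter_upwards [hlim, hlampos t] with ω hω hpos
  rw [hω.limsup_eq, max_eq_right hpos]
end

section
/- Under assumptions (A2) and (A3), the Markov kernel K of the chain (Z_t)_t is weak Feller with respect to the metric d, where d((y_1,…,y_p; λ_1,…,λ_q), (y'_1,…,y'_p; λ'_1,…,λ'_q)) = 1{(y_1,…,y_p) ≠ (y'_1,…,y'_p)} + Σ_{i=1}^q |λ_i − λ'_i|: for every state z and every sequence of states (z_n) with d(z_n, z) → 0, the measures K(z_n, ·) converge weakly to K(z, ·), i.e. ∫ φ dK(z_n,·) → ∫ φ dK(z,·) for every bounded continuous function φ on [0,∞)^{p+q}. -/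
open MeasureTheory ProbabilityTheory Filter
open scoped NNReal ENNReal Topology

/-- The total variation distance of two probability measures bounds the difference of their masses
on every measurable set. -/
theorem abs_measureReal_sub_le_tvDist {S : Type*} [MeasurableSpace S] (μ ν : Measure S)
    [IsProbabilityMeasure μ] [IsProbabilityMeasure ν] {A : Set S} (hA : MeasurableSet A) :
    |μ.real A - ν.real A| ≤ tvDist μ ν := by
  refine le_ciSup (f := fun A : {A : Set S // MeasurableSet A} =>
    |(μ A.1).toReal - (ν A.1).toReal|) ⟨1, ?_⟩ ⟨A, hA⟩
  rintro _ ⟨B, rfl⟩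
  change |μ.real B.1 - ν.real B.1| ≤ 1
  have h₁ : μ.real B.1 ≤ 1 := measureReal_le_one
  have h₂ : ν.real B.1 ≤ 1 := measureReal_le_one
  have h₃ : 0 ≤ μ.real B.1 := measureReal_nonneg
  have h₄ : 0 ≤ ν.real B.1 := measureReal_nonneg
  rw [abs_le]
  constructor <;> linarith

/-- Convergence in total variation implies weak convergence of probability measures. -/
theorem tendsto_probabilityMeasure_of_tendsto_tvDist {ι S : Type*} [MeasurableSpace S]
    [TopologicalSpace S] [OpensMeasurableSpace S] [HasOuterApproxClosed S] {L : Filter ι}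
    [L.IsCountablyGenerated]
    {P : ι → ProbabilityMeasure S} {P₀ : ProbabilityMeasure S}
    (h : Tendsto (fun i => tvDist (P i : Measure S) (P₀ : Measure S)) L (𝓝 0)) :
    Tendsto P L (𝓝 P₀) := by
  rcases L.eq_or_neBot with rfl | _
  · exact tendsto_bot
  refine tendsto_of_forall_isOpen_le_liminf' fun G hG => ?_
  have hreal : Tendsto (fun i => (P i : Measure S).real G) L (𝓝 ((P₀ : Measure S).real G)) := by
    rw [tendsto_iff_dist_tendsto_zero]
    exact squeeze_zero (fun _ => dist_nonneg)
      (fun i => abs_measureReal_sub_le_tvDist _ _ hG.measurableSet) h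
  have hmeas : Tendsto (fun i => (P i : Measure S) G) L (𝓝 ((P₀ : Measure S) G)) :=
    (ENNReal.tendsto_toReal_iff (fun i => measure_ne_top _ _) (measure_ne_top _ _)).1 hreal
  exact hmeas.liminf_eq.ge

/-- If `P i → P₀` weakly and `a i → a₀`, then the integrals of `Φ (·, a i)` against `P i` converge
to the integral of `Φ (·, a₀)` against `P₀`, for every bounded continuous `Φ`. -/
theorem tendsto_integral_of_tendsto_param {ι α β : Type*} [MeasurableSpace α] [TopologicalSpace α]
    [BorelSpace α] [SecondCountableTopology α] [TopologicalSpace.PseudoMetrizableSpace α]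
    [MeasurableSpace β] [TopologicalSpace β] [BorelSpace β] [SecondCountableTopology β]
    [TopologicalSpace.PseudoMetrizableSpace β] {L : Filter ι}
    {P : ι → ProbabilityMeasure α} {P₀ : ProbabilityMeasure α} (hP : Tendsto P L (𝓝 P₀))
    {a : ι → β} {a₀ : β} (ha : Tendsto a L (𝓝 a₀))
    {Φ : α × β → ℝ} (hΦ : Continuous Φ) {M : ℝ} (hM : ∀ x, |Φ x| ≤ M) :
    Tendsto (fun i => ∫ y, Φ (y, a i) ∂(P i : Measure α)) L
      (𝓝 (∫ y, Φ (y, a₀) ∂(P₀ : Measure α))) := by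
  have hprod : Tendsto (fun i => (P i).prod (diracProba (a i))) L
      (𝓝 (P₀.prod (diracProba a₀))) :=
    (ProbabilityMeasure.continuous_prod.tendsto (P₀, diracProba a₀)).comp
      (hP.prodMk_nhds ((continuous_diracProba.tendsto a₀).comp ha))
  have hint := ProbabilityMeasure.tendsto_iff_forall_integral_tendsto.1 hprod
    (BoundedContinuousFunction.ofNormedAddCommGroup Φ hΦ M hM)
  have key : ∀ (R : ProbabilityMeasure α) (b : β),
      ∫ x, Φ x ∂(R.prod (diracProba b) : Measure (α × β)) = ∫ y, Φ (y, b) ∂(R : Measure α) := by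
    intro R b
    rw [ProbabilityMeasure.toMeasure_prod, diracProba, ProbabilityMeasure.coe_mk,
      Measure.prod_dirac, integral_map (by fun_prop) hΦ.aestronglyMeasurable]
  simpa only [BoundedContinuousFunction.coe_ofNormedAddCommGroup, key] using hint

/-- under (A2) and (A3), the Markov kernel `K` of the chain `(Z_t)` is weak
Feller with respect to the metric
`d(z,z') = 1{(y₁,…,y_p) ≠ (y'₁,…,y'_p)} + Σᵢ |λᵢ − λ'ᵢ|`: if `d(z_n, z) → 0` then
`∫ φ dK(z_n,·) → ∫ φ dK(z,·)` for every bounded continuous `φ`. -/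
theorem stmt_17 (p q : ℕ)
    (Q : ℝ≥0 → Measure ℝ≥0) (hQprob : ∀ l, IsProbabilityMeasure (Q l))
    (hQmeas : ∀ A : Set ℝ≥0, MeasurableSet A → Measurable fun l => Q l A)
    (f : (Fin (p + 1) → ℝ≥0) → (Fin (q + 1) → ℝ≥0) → ℝ≥0)
    (hf : Measurable (Function.uncurry f))
    (K : Kernel ((Fin (p + 1) → ℝ≥0) × (Fin (q + 1) → ℝ≥0))
      ((Fin (p + 1) → ℝ≥0) × (Fin (q + 1) → ℝ≥0)))
    (hK : ∀ z, K z =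
      Measure.map (fun y' => (Fin.cons y' (Fin.init z.1), Fin.cons (f z.1 z.2) (Fin.init z.2)))
        (Q (f z.1 z.2)))
    -- (A2) semi-contractive condition
    (c : Fin (q + 1) → ℝ) (hc : ∀ i, 0 ≤ c i) (hcsum : ∑ i, c i < 1)
    (hcontr : ∀ (y : Fin (p + 1) → ℝ≥0) (z z' : Fin (q + 1) → ℝ≥0),
      |(f y z : ℝ) - (f y z' : ℝ)| ≤ ∑ i, c i * |(z i : ℝ) - (z' i : ℝ)|)
    -- (A3) similarity condition
    (δ : ℝ) (hδ : 0 < δ)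
    (hsim : ∀ l l' : ℝ≥0, tvDist (Q l) (Q l') ≤ 1 - Real.exp (-δ * |(l : ℝ) - (l' : ℝ)|)) :
    ∀ (z : (Fin (p + 1) → ℝ≥0) × (Fin (q + 1) → ℝ≥0))
      (zs : ℕ → (Fin (p + 1) → ℝ≥0) × (Fin (q + 1) → ℝ≥0)),
      Tendsto (fun n => (if (zs n).1 ≠ z.1 then (1 : ℝ) else 0)
          + ∑ i : Fin (q + 1), |((zs n).2 i : ℝ) - (z.2 i : ℝ)|) atTop (𝓝 0) →
      ∀ φ : ((Fin (p + 1) → ℝ≥0) × (Fin (q + 1) → ℝ≥0)) → ℝ,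
        Continuous φ → (∃ M : ℝ, ∀ x, |φ x| ≤ M) →
        Tendsto (fun n => ∫ x, φ x ∂(K (zs n))) atTop (𝓝 (∫ x, φ x ∂(K z))) := by
  intro z zs hd φ hφ ⟨M, hM⟩
  have hfst_nonneg : ∀ n, 0 ≤ if (zs n).1 ≠ z.1 then (1 : ℝ) else 0 := fun n => by
    split_ifs <;> norm_num
  have hsum_nonneg : ∀ n, 0 ≤ ∑ i : Fin (q + 1), |((zs n).2 i : ℝ) - (z.2 i : ℝ)| := fun n =>
    Finset.sum_nonneg fun i _ => abs_nonneg _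
  have hfst : ∀ᶠ n in atTop, (zs n).1 = z.1 := by
    filter_upwards [hd.eventually_lt_const one_pos] with n hn
    by_contra hne
    rw [if_pos hne] at hn
    linarith [hsum_nonneg n]
  have hcoord : ∀ i, Tendsto (fun n => |((zs n).2 i : ℝ) - (z.2 i : ℝ)|) atTop (𝓝 0) := fun i =>
    squeeze_zero (fun _ => abs_nonneg _) (fun n =>
      (Finset.single_le_sum (f := fun i => |((zs n).2 i : ℝ) - (z.2 i : ℝ)|)
        (fun _ _ => abs_nonneg _) (Finset.mem_univ i)).trans
        (le_add_of_nonneg_left (hfst_nonneg n))) hd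
  have hsnd : Tendsto (fun n => (zs n).2) atTop (𝓝 z.2) :=
    tendsto_pi_nhds.2 fun i => tendsto_iff_dist_tendsto_zero.2 (hcoord i)
  have hlam_abs : Tendsto (fun n => |(f (zs n).1 (zs n).2 : ℝ) - (f z.1 z.2 : ℝ)|) atTop (𝓝 0) := by
    have hbound : Tendsto (fun n => ∑ i, c i * |((zs n).2 i : ℝ) - (z.2 i : ℝ)|) atTop (𝓝 0) := by
      simpa using tendsto_finsetSum Finset.univ fun i _ => (hcoord i).const_mul (c i)
    refine squeeze_zero' (Eventually.of_forall fun _ => abs_nonneg _) ?_ hbound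
    filter_upwards [hfst] with n hn
    rw [hn]
    exact hcontr _ _ _
  have hlam : Tendsto (fun n => f (zs n).1 (zs n).2) atTop (𝓝 (f z.1 z.2)) :=
    tendsto_iff_dist_tendsto_zero.2 hlam_abs
  let P : ℝ≥0 → ProbabilityMeasure ℝ≥0 := fun l => ⟨Q l, hQprob l⟩
  have hP : Tendsto (fun n => P (f (zs n).1 (zs n).2)) atTop (𝓝 (P (f z.1 z.2))) := by
    refine tendsto_probabilityMeasure_of_tendsto_tvDist
      (squeeze_zero (fun n => ?_) (fun n => hsim _ _) ?_)
    · exact (abs_nonneg _).trans (abs_measureReal_sub_le_tvDist _ _ MeasurableSet.empty)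
    · have hexp := (Real.continuous_exp.tendsto _).comp (hlam_abs.const_mul (-δ))
      simpa using hexp.const_sub 1
  have hinit : Tendsto (fun n => (Fin.init (zs n).1 : Fin p → ℝ≥0)) atTop (𝓝 (Fin.init z.1)) :=
    tendsto_const_nhds.congr' (hfst.mono fun n hn => by simp only [hn])
  have hparam : Tendsto (fun n => ((Fin.init (zs n).1 : Fin p → ℝ≥0),
      (Fin.cons (f (zs n).1 (zs n).2) (Fin.init (zs n).2) : Fin (q + 1) → ℝ≥0))) atTop
      (𝓝 (Fin.init z.1, Fin.cons (f z.1 z.2) (Fin.init z.2))) :=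
    hinit.prodMk_nhds (hlam.finCons hsnd.finInit)
  have hcons : Continuous fun x : ℝ≥0 × (Fin p → ℝ≥0) × (Fin (q + 1) → ℝ≥0) =>
      ((Fin.cons x.1 x.2.1 : Fin (p + 1) → ℝ≥0), x.2.2) :=
    (Continuous.finCons (A := fun _ : Fin (p + 1) => ℝ≥0) continuous_fst
      continuous_snd.fst).prodMk continuous_snd.snd
  have hint := tendsto_integral_of_tendsto_param hP hparam (hφ.comp hcons) fun x => hM _
  have hK_int : ∀ w, ∫ x, φ x ∂(K w) = ∫ y, (φ ∘ fun x : ℝ≥0 × (Fin p → ℝ≥0) ×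
      (Fin (q + 1) → ℝ≥0) => ((Fin.cons x.1 x.2.1 : Fin (p + 1) → ℝ≥0), x.2.2))
      (y, Fin.init w.1, Fin.cons (f w.1 w.2) (Fin.init w.2)) ∂(P (f w.1 w.2) : Measure ℝ≥0) := by
    intro w
    have hmap : Continuous fun y : ℝ≥0 => ((Fin.cons y (Fin.init w.1) : Fin (p + 1) → ℝ≥0),
        (Fin.cons (f w.1 w.2) (Fin.init w.2) : Fin (q + 1) → ℝ≥0)) :=
      hcons.comp (Continuous.prodMk_left ((Fin.init w.1 : Fin p → ℝ≥0),
        (Fin.cons (f w.1 w.2) (Fin.init w.2) : Fin (q + 1) → ℝ≥0)))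
    rw [hK, integral_map hmap.measurable.aemeasurable hφ.aestronglyMeasurable]
    rfl
  simpa only [hK_int] using hint
end
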